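/- Let d ≥ 1, and let f : 𝕊_d → ℝ be a good function. Let μ = e^{-V(x)} dx and ν = e^{-W(x)} dx be probability measures on ℝ^d, where V, W : ℝ^d → ℝ are twice continuously differentiable, W is convex, and the Legendre transform W* is finite and twice continuously differentiable on ℝ^d. Assume there are constants Λ_V, λ_W > 0 such that f(∇²V(x)) ≤ Λ_V and f(∇²W*(x)) ≤ 1/λ_W for all x ∈ ℝ^d. Let φ : ℝ^d → ℝ be a twice continuously differentiable convex function whose gradient pushes μ forward to ν (the Brenier map from μ to ν). Then f(∇²φ(x)) ≤ √(Λ_V/λ_W) for every x ∈ ℝ^d. -/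

import Mathlib

open MeasureTheory Matrix
open scoped RealInnerProductSpace

/-- The Hessian matrix of `f : ℝ^d → ℝ` at `x`, with entries the second derivatives
in the coordinate directions. -/
noncomputable def hessianMatrix {d : ℕ} (f : EuclideanSpace ℝ (Fin d) → ℝ)
    (x : EuclideanSpace ℝ (Fin d)) : Matrix (Fin d) (Fin d) ℝ :=
  Matrix.of fun i j =>
    iteratedFDeriv ℝ 2 f x ![EuclideanSpace.single i (1:ℝ), EuclideanSpace.single j (1:ℝ)]

open Filter Topology

/-- Differentiation under the integral sign against a continuous compactly supported weight. -/
theorem hasFDerivAt_integral_weight {P H X : Type*} [NormedAddCommGroup P] [NormedSpace ℝ P]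
    [ProperSpace P] [NormedAddCommGroup H] [MeasurableSpace H] [BorelSpace H]
    [SecondCountableTopology H] [NormedAddCommGroup X] [NormedSpace ℝ X] (μ : Measure H)
    [IsFiniteMeasureOnCompacts μ] {w : H → ℝ} (hw : Continuous w) (hwc : HasCompactSupport w)
    {F : P → H → X} {F' : P → H → P →L[ℝ] X} (hF : Continuous (Function.uncurry F))
    (hF' : Continuous (Function.uncurry F')) (hd : ∀ p h, HasFDerivAt (fun q => F q h) (F' p h) p)
    (p : P) :
    HasFDerivAt (fun q => ∫ h, w h • F q h ∂μ) (∫ h, w h • F' p h ∂μ) p := by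
  have hK : IsCompact (Metric.closedBall p 1 ×ˢ tsupport w) :=
    (isCompact_closedBall p 1).prod hwc
  obtain ⟨C, hC⟩ := hK.exists_bound_of_continuousOn hF'.continuousOn
  have hgi : ∀ q, Integrable (fun h => w h • F q h) μ := fun q =>
    (hw.smul (hF.comp (Continuous.prodMk_right q))).integrable_of_hasCompactSupport
      hwc.smul_right
  refine hasFDerivAt_integral_of_dominated_of_fderiv_le (bound := fun h => ‖w h‖ * C)
    (F := fun q h => w h • F q h) (F' := fun q h => w h • F' q h)
    (Metric.ball_mem_nhds p one_pos) ?_ (hgi p) ?_ ?_ ?_ ?_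
  · exact Eventually.of_forall fun q => (hgi q).aestronglyMeasurable
  · exact ((hw.smul (hF'.comp (Continuous.prodMk_right p))).integrable_of_hasCompactSupport
      hwc.smul_right).aestronglyMeasurable
  · refine Eventually.of_forall fun h q hq => ?_
    rw [norm_smul]
    by_cases hh : h ∈ tsupport w
    · exact mul_le_mul_of_nonneg_left (hC (q, h) ⟨Metric.ball_subset_closedBall hq, hh⟩)
        (norm_nonneg _)
    · simp [image_eq_zero_of_notMem_tsupport hh]
  · exact (hw.norm.integrable_of_hasCompactSupport hwc.norm).mul_const C
  · exact Eventually.of_forall fun h q _ => (hd q h).const_smul (w h)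

theorem continuous_integral_weight {P H X : Type*} [TopologicalSpace P]
    [FirstCountableTopology P] [LocallyCompactSpace P]
    [NormedAddCommGroup H] [MeasurableSpace H] [BorelSpace H]
    [SecondCountableTopology H]
    [NormedAddCommGroup X] [NormedSpace ℝ X] (μ : Measure H)
    [IsLocallyFiniteMeasure μ] {w : H → ℝ} (hw : Continuous w) (hwc : HasCompactSupport w)
    {F : P → H → X} (hF : Continuous (Function.uncurry F)) :
    Continuous (fun q => ∫ h, w h • F q h ∂μ) := by
  have h1 : ∀ q, ∫ h, w h • F q h ∂μ = ∫ h in tsupport w, w h • F q h ∂μ := fun q => by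
    refine (setIntegral_eq_integral_of_forall_compl_eq_zero fun h hh => ?_).symm
    simp [image_eq_zero_of_notMem_tsupport hh]
  simp_rw [h1]
  exact continuous_parametric_integral_of_continuous
    ((hw.comp continuous_snd).smul hF) hwc

section Kernel

variable {E : Type*} [NormedAddCommGroup E]

/-- A radial averaging weight supported in the unit ball. -/
noncomputable def averagingWeight (h : E) : ℝ := (max (1 - ‖h‖ ^ 2) 0) ^ 2

/-- A radial potential of the averaging weight: its gradient is `-averagingWeight h • h`. -/
noncomputable def averagingPotential (h : E) : ℝ := (max (1 - ‖h‖ ^ 2) 0) ^ 3 / 6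

theorem averagingWeight_nonneg (h : E) : 0 ≤ averagingWeight h := sq_nonneg _

theorem averagingPotential_nonneg (h : E) : 0 ≤ averagingPotential h := by
  unfold averagingPotential; positivity

@[fun_prop]
theorem continuous_averagingWeight : Continuous (averagingWeight : E → ℝ) := by
  unfold averagingWeight; fun_prop

@[fun_prop]
theorem continuous_averagingPotential : Continuous (averagingPotential : E → ℝ) := by
  unfold averagingPotential; fun_prop

theorem max_one_sub_eq_zero {h : E} (hh : h ∉ Metric.closedBall (0 : E) 1) :
    max (1 - ‖h‖ ^ 2) 0 = 0 := by
  rw [mem_closedBall_zero_iff, not_le] at hh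
  exact max_eq_right (by nlinarith)

theorem hasCompactSupport_averagingWeight [ProperSpace E] :
    HasCompactSupport (averagingWeight : E → ℝ) :=
  HasCompactSupport.intro (isCompact_closedBall 0 1) fun h hh => by
    simp [averagingWeight, max_one_sub_eq_zero hh]

theorem hasCompactSupport_averagingPotential [ProperSpace E] :
    HasCompactSupport (averagingPotential : E → ℝ) :=
  HasCompactSupport.intro (isCompact_closedBall 0 1) fun h hh => by
    simp [averagingPotential, max_one_sub_eq_zero hh]

theorem hasDerivAt_max_zero_pow_three (t : ℝ) :
    HasDerivAt (fun s : ℝ => (max s 0) ^ 3) (3 * (max t 0) ^ 2) t := by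
  rcases lt_trichotomy t 0 with ht | rfl | ht
  · have : (fun s : ℝ => (max s 0) ^ 3) =ᶠ[𝓝 t] fun _ => 0 := by
      filter_upwards [Iio_mem_nhds ht] with s hs
      simp [max_eq_right (le_of_lt (Set.mem_Iio.1 hs))]
    rw [max_eq_right ht.le]
    simpa using (hasDerivAt_const t (0 : ℝ)).congr_of_eventuallyEq this
  · rw [hasDerivAt_iff_isLittleO_nhds_zero]
    have : (fun h : ℝ => (max (0 + h) 0) ^ 3 - (max (0 : ℝ) 0) ^ 3 - h • (3 * (max (0:ℝ) 0) ^ 2))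
        = fun h : ℝ => (max h 0) ^ 3 := by
      funext h; simp
    rw [this]
    have h2 : (fun h : ℝ => (max h 0) ^ 3) =O[𝓝 0] fun h : ℝ => h ^ 3 := by
      refine Asymptotics.IsBigO.of_bound 1 (Eventually.of_forall fun h => ?_)
      rw [one_mul, norm_pow, norm_pow]
      gcongr
      rw [Real.norm_eq_abs, Real.norm_eq_abs, abs_of_nonneg (le_max_right _ _)]
      exact max_le (le_abs_self h) (abs_nonneg h)
    refine h2.trans_isLittleO ?_
    simpa using Asymptotics.isLittleO_pow_pow (𝕜 := ℝ) (show 1 < 3 by norm_num)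
  · have : (fun s : ℝ => (max s 0) ^ 3) =ᶠ[𝓝 t] fun s => s ^ 3 := by
      filter_upwards [Ioi_mem_nhds ht] with s hs
      simp [max_eq_left (le_of_lt (Set.mem_Ioi.1 hs))]
    rw [max_eq_left ht.le]
    simpa using (hasDerivAt_pow 3 t).congr_of_eventuallyEq this

theorem hasFDerivAt_averagingPotential [InnerProductSpace ℝ E] (h : E) :
    HasFDerivAt (averagingPotential : E → ℝ) (-(averagingWeight h) • innerSL ℝ h) h := by
  have h1 : HasFDerivAt (fun x : E => 1 - ‖x‖ ^ 2) (-(2 • innerSL ℝ h)) h := by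
    simpa using (hasStrictFDerivAt_norm_sq h).hasFDerivAt.const_sub 1
  have h2 := ((hasDerivAt_max_zero_pow_three (1 - ‖h‖ ^ 2)).comp_hasFDerivAt h h1).const_mul (1 / 6)
  have h3 : (averagingPotential : E → ℝ) =
      fun x => 1 / 6 * ((fun s : ℝ => (max s 0) ^ 3) ∘ fun x : E => 1 - ‖x‖ ^ 2) x := by
    funext x; simp [averagingPotential]; ring
  rw [h3]
  refine h2.congr_fderiv ?_
  ext v
  simp [averagingWeight]
  ring

end Kernel

section Euclidean

variable {d : ℕ}

local notation "𝔼" => EuclideanSpace ℝ (Fin d)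

theorem integral_coord_mul_averagingWeight {F : 𝔼 → ℝ} (hF : ContDiff ℝ 1 F) (i : Fin d) :
    ∫ h : 𝔼, averagingWeight h * (h i * F h) =
      ∫ h : 𝔼, averagingPotential h * fderiv ℝ F h (EuclideanSpace.single i 1) := by
  have hd : Differentiable ℝ (averagingPotential : 𝔼 → ℝ) := fun h =>
    (hasFDerivAt_averagingPotential h).differentiableAt
  have hfd : ∀ h : 𝔼, fderiv ℝ averagingPotential h (EuclideanSpace.single i 1) =
      -(averagingWeight h * h i) := fun h => by
    rw [(hasFDerivAt_averagingPotential h).fderiv]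
    simp [EuclideanSpace.inner_single_right]
  have hFc : Continuous fun h : 𝔼 => fderiv ℝ F h (EuclideanSpace.single i 1) :=
    (hF.continuous_fderiv one_ne_zero).clm_apply continuous_const
  have hco : Continuous fun h : 𝔼 => h i := by fun_prop
  have := integral_mul_fderiv_eq_neg_fderiv_mul_of_integrable (μ := volume)
    (f := (averagingPotential : 𝔼 → ℝ)) (g := F) (v := EuclideanSpace.single i 1) ?_ ?_ ?_
    (fun x _ => hd x) (fun x _ => hF.differentiable one_ne_zero x)
  · rw [this, ← integral_neg]
    refine integral_congr_ae (Eventually.of_forall fun h => ?_)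
    simp only [hfd]; ring
  · simp_rw [hfd]
    exact (((continuous_averagingWeight.mul hco).neg).mul hF.continuous)
      |>.integrable_of_hasCompactSupport
        (HasCompactSupport.mul_right (hasCompactSupport_averagingWeight.mul_right.neg))
  · exact (continuous_averagingPotential.mul hFc).integrable_of_hasCompactSupport
      hasCompactSupport_averagingPotential.mul_right
  · exact (continuous_averagingPotential.mul hF.continuous).integrable_of_hasCompactSupport
      hasCompactSupport_averagingPotential.mul_right

/-- The trace of `Lᵀ (∇²F) L`. -/
noncomputable def weightedLaplacian (L : 𝔼 →L[ℝ] 𝔼) (F : 𝔼 → ℝ) (x : 𝔼) : ℝ :=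
  ∑ i, fderiv ℝ (fderiv ℝ F) x (L (EuclideanSpace.single i 1)) (L (EuclideanSpace.single i 1))

theorem continuous_weightedLaplacian (L : 𝔼 →L[ℝ] 𝔼) {F : 𝔼 → ℝ} (hF : ContDiff ℝ 2 F) :
    Continuous (weightedLaplacian L F) := by
  have : Continuous (fderiv ℝ (fderiv ℝ F)) :=
    (hF.fderiv_right (m := 1) (by norm_num)).continuous_fderiv one_ne_zero
  unfold weightedLaplacian
  fun_prop

/-- First variation of the average of `F` along an ellipsoid. -/
theorem integral_averagingWeight_mul_fderiv (L : 𝔼 →L[ℝ] 𝔼) {F : 𝔼 → ℝ} (hF : ContDiff ℝ 2 F)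
    (x : 𝔼) (s : ℝ) :
    ∫ h : 𝔼, averagingWeight h * fderiv ℝ F (x + s • L h) (L h) =
      s * ∫ h : 𝔼, averagingPotential h * weightedLaplacian L F (x + s • L h) := by
  have hF1 : ContDiff ℝ 1 (fderiv ℝ F) := hF.fderiv_right (by norm_num)
  have hG : ∀ v : 𝔼, ContDiff ℝ 1 fun h : 𝔼 => fderiv ℝ F (x + s • L h) v := fun v => by
    have : ContDiff ℝ 1 fun h : 𝔼 => x + s • L h := by fun_prop
    exact (hF1.comp this).clm_apply contDiff_const
  have hGd : ∀ v u h : 𝔼, fderiv ℝ (fun h : 𝔼 => fderiv ℝ F (x + s • L h) v) h u =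
      s * fderiv ℝ (fderiv ℝ F) (x + s • L h) (L u) v := fun v u h => by
    have h1 : HasFDerivAt (fun h : 𝔼 => x + s • L h) (s • L) h :=
      (L.hasFDerivAt.const_smul s).const_add x
    have h2 := ((hF1.differentiable one_ne_zero (x + s • L h)).hasFDerivAt.comp h h1)
    have h3 := h2.clm_apply (hasFDerivAt_const v h)
    have h4 := congrArg (fun T => T u) h3.fderiv
    simpa using h4
  have hexp : ∀ h : 𝔼, fderiv ℝ F (x + s • L h) (L h) =
      ∑ i, h i * fderiv ℝ F (x + s • L h) (L (EuclideanSpace.single i 1)) := fun h => by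
    conv_lhs => rw [show L h = ∑ i, h i • L (EuclideanSpace.single i 1) by
      conv_lhs => rw [← (EuclideanSpace.basisFun (Fin d) ℝ).sum_repr h]
      simp, map_sum]
    refine Finset.sum_congr rfl fun i _ => ?_
    rw [map_smul, smul_eq_mul]
    congr 3
    conv_rhs => rw [← (EuclideanSpace.basisFun (Fin d) ℝ).sum_repr h]
    simp
  have hlap : Continuous fun h : 𝔼 => fderiv ℝ (fderiv ℝ F) (x + s • L h) := by
    have := hF1.continuous_fderiv one_ne_zero
    fun_prop
  simp_rw [hexp, Finset.mul_sum, weightedLaplacian, Finset.mul_sum]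
  rw [integral_finsetSum, integral_finsetSum, Finset.mul_sum]
  · refine Finset.sum_congr rfl fun i _ => ?_
    rw [integral_coord_mul_averagingWeight (hG _) i, ← integral_const_mul]
    simp_rw [hGd]
    congr 1; funext h; ring
  · intro i _
    refine (continuous_averagingPotential.mul ?_).integrable_of_hasCompactSupport
      hasCompactSupport_averagingPotential.mul_right
    fun_prop
  · intro i _
    have := (hG (L (EuclideanSpace.single i 1))).continuous
    refine (continuous_averagingWeight.mul ?_).integrable_of_hasCompactSupport
      hasCompactSupport_averagingWeight.mul_right
    fun_prop

/-- The average of `F` over the ellipsoid `x + r L B`. -/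
noncomputable def ellipsoidAverage (L : 𝔼 →L[ℝ] 𝔼) (F : 𝔼 → ℝ) (r : ℝ) (x : 𝔼) : ℝ :=
  ∫ h : 𝔼, averagingWeight h * F (x + r • L h)

theorem hasDerivAt_ellipsoidAverage (L : 𝔼 →L[ℝ] 𝔼) {F : 𝔼 → ℝ} (hF : ContDiff ℝ 2 F)
    (x : 𝔼) (s : ℝ) :
    HasDerivAt (fun r => ellipsoidAverage L F r x)
      (s * ∫ h : 𝔼, averagingPotential h * weightedLaplacian L F (x + s • L h)) s := by
  have hF1 : Continuous (fderiv ℝ F) := hF.continuous_fderiv two_ne_zero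
  have hsp : Continuous fun h : 𝔼 => ContinuousLinearMap.toSpanSingleton ℝ (L h) :=
    (ContinuousLinearMap.toSpanSingletonCLE (𝕜 := ℝ) (E := 𝔼)).continuous.comp L.continuous
  have := hasFDerivAt_integral_weight (P := ℝ) (volume : Measure 𝔼) continuous_averagingWeight
    hasCompactSupport_averagingWeight (F := fun r h => F (x + r • L h))
    (F' := fun r h => (fderiv ℝ F (x + r • L h)).comp
      (ContinuousLinearMap.toSpanSingleton ℝ (L h)))
    (by have := hF.continuous; unfold Function.uncurry; fun_prop)
    (by
      have := hsp.comp (continuous_snd : Continuous fun p : ℝ × 𝔼 => p.2)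
      unfold Function.uncurry; fun_prop) (fun r h => by
      refine (hF.differentiable two_ne_zero _).hasFDerivAt.comp r ?_
      have := ((hasDerivAt_id r).smul_const (L h)).const_add x
      simpa [hasDerivAt_iff_hasFDerivAt] using this) s
  have h2 := this.hasDerivAt
  rw [← integral_averagingWeight_mul_fderiv L hF]
  refine h2.congr_deriv ?_
  rw [ContinuousLinearMap.integral_apply]
  · simp
  · refine (continuous_averagingWeight.smul ?_).integrable_of_hasCompactSupport
      hasCompactSupport_averagingWeight.smul_right
    fun_prop

theorem ellipsoidAverage_sub_le (L : 𝔼 →L[ℝ] 𝔼) {F : 𝔼 → ℝ} (hF : ContDiff ℝ 2 F)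
    {K r : ℝ} (hr : 0 ≤ r) (x : 𝔼)
    (hK : ∀ s ∈ Set.Icc 0 r,
      ∫ h : 𝔼, averagingPotential h * weightedLaplacian L F (x + s • L h) ≤ K) :
    ellipsoidAverage L F r x - ellipsoidAverage L F 0 x ≤ r ^ 2 / 2 * K := by
  have hd : ∀ s, HasDerivAt (fun s => ellipsoidAverage L F s x - s ^ 2 / 2 * K)
      (s * (∫ h : 𝔼, averagingPotential h * weightedLaplacian L F (x + s • L h)) - s * K) s :=
    fun s => by
      refine (hasDerivAt_ellipsoidAverage L hF x s).sub ?_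
      have := ((hasDerivAt_pow 2 s).div_const 2).mul_const K
      refine this.congr_deriv ?_
      simp
  have hanti : AntitoneOn (fun s => ellipsoidAverage L F s x - s ^ 2 / 2 * K) (Set.Icc 0 r) := by
    refine antitoneOn_of_deriv_nonpos (convex_Icc 0 r)
      (fun s _ => (hd s).continuousAt.continuousWithinAt)
      (fun s _ => (hd s).differentiableAt.differentiableWithinAt) fun s hs => ?_
    rw [interior_Icc] at hs
    rw [(hd s).deriv]
    have := hK s ⟨hs.1.le, hs.2.le⟩
    nlinarith [hs.1]
  have := hanti (Set.left_mem_Icc.2 hr) (Set.right_mem_Icc.2 hr) hr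
  simp only at this
  linarith

/-- Mean value inequality: a bound on the Laplacian controls the averages. -/
theorem ellipsoidAverage_sub_le_of_laplacian_le (L : 𝔼 →L[ℝ] 𝔼) {F : 𝔼 → ℝ}
    (hF : ContDiff ℝ 2 F) {K r : ℝ} (hr : 0 ≤ r) (hK : ∀ x, weightedLaplacian L F x ≤ K)
    (x : 𝔼) :
    ellipsoidAverage L F r x - ellipsoidAverage L F 0 x ≤
      r ^ 2 / 2 * (K * ∫ h : 𝔼, averagingPotential h) := by
  refine ellipsoidAverage_sub_le L hF hr x fun s _ => ?_
  rw [← integral_const_mul]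
  have hc := continuous_weightedLaplacian L hF
  refine integral_mono ?_ ?_ fun h => ?_
  · refine (continuous_averagingPotential.mul ?_).integrable_of_hasCompactSupport
      hasCompactSupport_averagingPotential.mul_right
    fun_prop
  · exact (continuous_averagingPotential.integrable_of_hasCompactSupport
      hasCompactSupport_averagingPotential).const_mul K
  · simp only
    rw [mul_comm]
    exact mul_le_mul_of_nonneg_right (hK _) (averagingPotential_nonneg h)

theorem tendsto_integral_averagingPotential (L : 𝔼 →L[ℝ] 𝔼) {F : 𝔼 → ℝ}
    (hF : ContDiff ℝ 2 F) (x : 𝔼) :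
    Tendsto (fun s : ℝ => ∫ h : 𝔼, averagingPotential h * weightedLaplacian L F (x + s • L h))
      (𝓝 0) (𝓝 (weightedLaplacian L F x * ∫ h : 𝔼, averagingPotential h)) := by
  have hc := continuous_weightedLaplacian L hF
  have := (continuous_integral_weight (P := ℝ) (volume : Measure 𝔼) continuous_averagingPotential
    hasCompactSupport_averagingPotential (F := fun s h => weightedLaplacian L F (x + s • L h))
    (by unfold Function.uncurry; fun_prop)).tendsto 0
  simpa [integral_mul_const, integral_const_mul, mul_comm] using this

theorem tendsto_ellipsoidAverage (L : 𝔼 →L[ℝ] 𝔼) {F : 𝔼 → ℝ} (hF : ContDiff ℝ 2 F) (x : 𝔼) :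
    Tendsto (fun r => (ellipsoidAverage L F r x - ellipsoidAverage L F 0 x) / r ^ 2)
      (𝓝[>] 0) (𝓝 (weightedLaplacian L F x * (∫ h : 𝔼, averagingPotential h) / 2)) := by
  have h0 := tendsto_integral_averagingPotential L hF x
  set c := weightedLaplacian L F x * ∫ h : 𝔼, averagingPotential h with hcdef
  have hneg : ∀ r, ellipsoidAverage L (-F) r x = - ellipsoidAverage L F r x := fun r => by
    simp [ellipsoidAverage, integral_neg]
  have hlneg : ∀ y, weightedLaplacian L (-F) y = - weightedLaplacian L F y := fun y => by
    have : fderiv ℝ (-F) = -fderiv ℝ F := by funext z; simp [fderiv_neg]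
    simp [weightedLaplacian, this, fderiv_neg]
  rw [Metric.tendsto_nhdsWithin_nhds]
  intro ε hε
  obtain ⟨δ, hδ, hlt⟩ := Metric.tendsto_nhds_nhds.1 h0 ε hε
  refine ⟨δ, hδ, fun r hr hrd => ?_⟩
  have hr0 : 0 < r := hr
  rw [Real.dist_eq, sub_zero, abs_of_pos hr0] at hrd
  have hb : ∀ s ∈ Set.Icc 0 r,
      |(∫ h : 𝔼, averagingPotential h * weightedLaplacian L F (x + s • L h)) - c| < ε :=
    fun s hs => hlt (by
      rw [Real.dist_eq, sub_zero, abs_of_nonneg hs.1]; exact hs.2.trans_lt hrd)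
  have hup := ellipsoidAverage_sub_le L hF hr0.le x (K := c + ε) fun s hs => by
    linarith [(abs_lt.1 (hb s hs)).2]
  have hlo := ellipsoidAverage_sub_le L hF.neg hr0.le x (K := -c + ε) fun s hs => by
    change ∫ h : 𝔼, averagingPotential h * weightedLaplacian L (-F) (x + s • L h) ≤ _
    simp_rw [hlneg, mul_neg, integral_neg]
    linarith [(abs_lt.1 (hb s hs)).1]
  change ellipsoidAverage L (-F) r x - ellipsoidAverage L (-F) 0 x ≤ _ at hlo
  rw [hneg, hneg] at hlo
  rw [Real.dist_eq]
  have hr2 : 0 < r ^ 2 := by positivity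
  refine lt_of_le_of_lt (b := ε / 2) ?_ (by linarith)
  rw [abs_le]
  constructor
  · rw [neg_le_sub_iff_le_add, ← sub_le_iff_le_add, le_div_iff₀ hr2]
    nlinarith
  · rw [sub_le_iff_le_add, div_le_iff₀ hr2]
    nlinarith

end Euclidean

section MatrixLemmas

variable {n : Type*} [Fintype n]

open scoped MatrixOrder in
theorem Matrix.PosSemidef.exists_eq_transpose_mul_self [DecidableEq n] {A : Matrix n n ℝ}
    (hA : A.PosSemidef) : ∃ C : Matrix n n ℝ, A = Cᵀ * C := by
  obtain ⟨C, rfl⟩ := CStarAlgebra.nonneg_iff_eq_star_mul_self.mp hA.nonneg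
  exact ⟨C, by rw [star_eq_conjTranspose, conjTranspose_eq_transpose_of_trivial]⟩

/-- The logarithm of the determinant lies below its tangent planes. -/
theorem Matrix.PosDef.log_det_sub_le [DecidableEq n] {A B : Matrix n n ℝ} (hA : A.PosDef)
    (hB : B.PosDef) :
    Real.log B.det - Real.log A.det ≤ (A⁻¹ * B).trace - Fintype.card n := by
  obtain ⟨C, hC⟩ := hA.inv.posSemidef.exists_eq_transpose_mul_self
  have hP : (C * B * Cᵀ).PosSemidef := by
    simpa [conjTranspose_eq_transpose_of_trivial] using hB.posSemidef.mul_mul_conjTranspose_same C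
  have hAd := hA.det_pos
  have hBd := hB.det_pos
  have hdet : (C * B * Cᵀ).det = B.det / A.det := by
    have h1 : (Cᵀ * C).det = A.det⁻¹ := by
      rw [← hC, det_nonsing_inv, Ring.inverse_eq_inv']
    rw [det_mul] at h1
    rw [det_mul, det_mul, div_eq_mul_inv, ← h1]; ring
  have htr : (C * B * Cᵀ).trace = (A⁻¹ * B).trace := by
    rw [trace_mul_comm, ← Matrix.mul_assoc, ← hC]
  have hpos : 0 < (C * B * Cᵀ).det := by rw [hdet]; positivity
  rw [← Real.log_div hBd.ne' hAd.ne', ← hdet, ← htr, hP.1.det_eq_prod_eigenvalues,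
    hP.1.trace_eq_sum_eigenvalues]
  rw [hP.1.det_eq_prod_eigenvalues] at hpos
  have hne : ∀ i ∈ Finset.univ, (hP.1.eigenvalues i : ℝ) ≠ 0 := Finset.prod_ne_zero_iff.1 hpos.ne'
  simp only [RCLike.ofReal_real_eq_id, id_eq] at hne ⊢
  rw [Real.log_prod hne]
  calc ∑ i, Real.log (hP.1.eigenvalues i) ≤ ∑ i, (hP.1.eigenvalues i - 1) :=
        Finset.sum_le_sum fun i hi =>
          Real.log_le_sub_one_of_pos (lt_of_le_of_ne (hP.eigenvalues_nonneg i) (hne i hi).symm)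
    _ = _ := by simp

theorem Matrix.PosSemidef.smul_sub_vecMulVec [DecidableEq n] {M : Matrix n n ℝ}
    (hM : M.PosSemidef) (w : n → ℝ) :
    ((w ⬝ᵥ M *ᵥ w) • M - vecMulVec (M *ᵥ w) (M *ᵥ w)).PosSemidef := by
  obtain ⟨C, rfl⟩ := hM.exists_eq_transpose_mul_self
  have key : ∀ x y : n → ℝ, x ⬝ᵥ (Cᵀ * C) *ᵥ y = (C *ᵥ x) ⬝ᵥ (C *ᵥ y) := fun x y => by
    rw [← mulVec_mulVec, dotProduct_mulVec, vecMul_transpose]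
  refine PosSemidef.of_dotProduct_mulVec_nonneg ?_ fun x => ?_
  · rw [IsHermitian, conjTranspose_eq_transpose_of_trivial]
    simp [transpose_sub, transpose_smul, transpose_mul, transpose_vecMulVec]
  · rw [star_trivial, sub_mulVec, smul_mulVec, dotProduct_sub, dotProduct_smul,
      vecMulVec_mulVec, dotProduct_smul, key, key, key x w, dotProduct_comm ((Cᵀ * C) *ᵥ w) x, key]
    have := Finset.sum_mul_sq_le_sq_mul_sq Finset.univ (C *ᵥ x) (C *ᵥ w)
    simp only [dotProduct, smul_eq_mul, MulOpposite.smul_eq_mul_unop, MulOpposite.unop_op] at this ⊢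
    simp only [← pow_two] at this ⊢
    linarith

end MatrixLemmas

section GoodFunction

variable {n : Type*} [Fintype n] [DecidableEq n] {f : Matrix n n ℝ → ℝ}

/-- A convex, positively homogeneous function on symmetric matrices that is increasing on the
positive cone is supported at a positive definite matrix by `X ↦ Tr (Cᵀ X C)`. -/
theorem exists_trace_support
    (hf_convex : ConvexOn ℝ {A : Matrix n n ℝ | A.IsSymm} f)
    (hf_mono : ∀ X X' : Matrix n n ℝ, X.PosSemidef → (X' - X).PosSemidef → f X ≤ f X')
    (hf_hom : ∀ t : ℝ, 0 < t → ∀ X : Matrix n n ℝ, X.IsSymm → f (t • X) = t * f X)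
    {A : Matrix n n ℝ} (hA : A.PosDef) :
    ∃ C : Matrix n n ℝ, (∀ X : Matrix n n ℝ, X.IsSymm → (Cᵀ * X * C).trace ≤ f X) ∧
      (Cᵀ * A * C).trace = f A := by
  have hAs : A.IsSymm := by
    have := hA.1; rwa [IsHermitian, conjTranspose_eq_transpose_of_trivial] at this
  have hf0 : f 0 = 0 := by
    have := hf_hom 2 two_pos 0 (by simp [IsSymm])
    rw [smul_zero] at this; linarith
  have hsub : ∀ X Y : Matrix n n ℝ, X.IsSymm → Y.IsSymm → f (X + Y) ≤ f X + f Y := by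
    intro X Y hX hY
    have h1 := hf_convex.2
    replace h1 := h1 hX hY (by norm_num : (0 : ℝ) ≤ 1 / 2) (by norm_num : (0 : ℝ) ≤ 1 / 2)
      (by norm_num)
    have h2 := hf_hom (1 / 2) (by norm_num) (X + Y) (hX.add hY)
    rw [← smul_add, h2] at h1
    simp only [smul_eq_mul] at h1
    linarith
  let N : Matrix n n ℝ → ℝ := fun X => f ((1 / 2 : ℝ) • (X + Xᵀ))
  have hsymm : ∀ X : Matrix n n ℝ, ((1 / 2 : ℝ) • (X + Xᵀ)).IsSymm := fun X => by
    rw [IsSymm]; simp [transpose_add, transpose_smul, add_comm]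
  have hNs : ∀ X : Matrix n n ℝ, X.IsSymm → N X = f X := fun X hX => by
    have : (1 / 2 : ℝ) • (X + Xᵀ) = X := by
      rw [hX.eq, ← two_smul ℝ X, smul_smul]; norm_num
    simp only [N, this]
  obtain ⟨g, hgA, hgN⟩ : ∃ g : Matrix n n ℝ →ₗ[ℝ] ℝ, g A = f A ∧ ∀ X, g X ≤ N X := by
    have hN1 : ∀ c : ℝ, 0 < c → ∀ X, N (c • X) = c * N X := fun c hc X => by
      simp only [N]
      rw [← hf_hom c hc _ (hsymm X)]
      congr 1
      rw [transpose_smul, ← smul_add, smul_comm]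
    have hN2 : ∀ X Y, N (X + Y) ≤ N X + N Y := fun X Y => by
      simp only [N]
      rw [show (1 / 2 : ℝ) • (X + Y + (X + Y)ᵀ) =
        (1 / 2 : ℝ) • (X + Xᵀ) + (1 / 2 : ℝ) • (Y + Yᵀ) by
          rw [transpose_add, ← smul_add]; congr 1; abel]
      exact hsub _ _ (hsymm X) (hsymm Y)
    by_cases hA0 : A = 0
    · obtain ⟨g, -, hg⟩ := exists_extension_of_le_sublinear
        (⟨⊥, 0⟩ : Matrix n n ℝ →ₗ.[ℝ] ℝ) N hN1 hN2 (by
          rintro ⟨x, hx⟩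
          have hx' : x = 0 := (Submodule.mem_bot ℝ).1 hx
          subst hx'
          simp [N, hf0])
      exact ⟨g, by rw [hA0, hf0, map_zero], hg⟩
    · obtain ⟨g, hg1, hg⟩ := exists_extension_of_le_sublinear
        (LinearPMap.mkSpanSingleton A (f A) hA0) N hN1 hN2 (by
          rintro ⟨x, hx⟩
          obtain ⟨t, rfl⟩ := Submodule.mem_span_singleton.1 hx
          rw [LinearPMap.mkSpanSingleton'_apply, hNs _ (by rw [IsSymm, transpose_smul, hAs.eq]),
            smul_eq_mul]
          change t * f A ≤ f (t • A)
          rcases lt_trichotomy t 0 with ht | rfl | ht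
          · have h1 := hsub (t • A) ((-t) • A) (by rw [IsSymm, transpose_smul, hAs.eq])
              (by rw [IsSymm, transpose_smul, hAs.eq])
            rw [← add_smul, add_neg_cancel, zero_smul, hf0, hf_hom (-t) (by linarith) A hAs] at h1
            linarith
          · simp [hf0]
          · exact (hf_hom t ht A hAs).ge)
      refine ⟨g, ?_, hg⟩
      have := hg1 ⟨A, Submodule.mem_span_singleton_self A⟩
      rw [this]
      exact LinearPMap.mkSpanSingleton_apply ℝ ℝ hA0 (f A)
  have hganti : ∀ X : Matrix n n ℝ, g Xᵀ = g X := fun X => by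
    have h0 : ∀ Y : Matrix n n ℝ, N (Y - Yᵀ) = 0 := fun Y => by
      have h : (1 / 2 : ℝ) • (Y - Yᵀ + (Y - Yᵀ)ᵀ) = 0 := by
        rw [transpose_sub, transpose_transpose, sub_add_sub_cancel, sub_self, smul_zero]
      simp only [N, h, hf0]
    have h1 := (hgN (X - Xᵀ)).trans_eq (h0 X)
    have h2 := (hgN (Xᵀ - Xᵀᵀ)).trans_eq (h0 Xᵀ)
    rw [transpose_transpose] at h2
    rw [map_sub] at h1 h2
    linarith
  let B : Matrix n n ℝ := Matrix.of fun i j => g (Matrix.single i j 1)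
  have hgB : ∀ X : Matrix n n ℝ, g X = (Xᵀ * B).trace := fun X => by
    conv_lhs => rw [matrix_eq_sum_single X]
    rw [map_sum, trace]
    simp only [map_sum, diag_apply, mul_apply, transpose_apply]
    rw [Finset.sum_comm]
    refine Finset.sum_congr rfl fun j _ => Finset.sum_congr rfl fun i _ => ?_
    have : Matrix.single i j (X i j) = X i j • Matrix.single i j (1 : ℝ) := by
      rw [smul_single, smul_eq_mul, mul_one]
    rw [this, map_smul, smul_eq_mul]
    rfl
  have hB : B.PosSemidef := by
    refine PosSemidef.of_dotProduct_mulVec_nonneg ?_ fun v => ?_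
    · rw [IsHermitian, conjTranspose_eq_transpose_of_trivial]
      ext i j
      simp only [B, transpose_apply, of_apply]
      rw [← hganti, transpose_single]
    · have hv : star v ⬝ᵥ B *ᵥ v = g (vecMulVec v v) := by
        rw [hgB, transpose_vecMulVec, vecMulVec_mul, trace_vecMulVec, star_trivial,
          dotProduct_mulVec, dotProduct_comm]
      rw [hv]
      obtain ⟨w, rfl⟩ : ∃ w, v = A *ᵥ w := ⟨A⁻¹ *ᵥ v, by
        rw [mulVec_mulVec, mul_nonsing_inv _ hA.det_pos.ne'.isUnit, one_mulVec]⟩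
      rcases eq_or_ne w 0 with rfl | hw
      · simp
      have ht : 0 < w ⬝ᵥ A *ᵥ w := by simpa using hA.dotProduct_mulVec_pos hw
      set t := w ⬝ᵥ A *ᵥ w
      have h1 := hA.posSemidef.smul_sub_vecMulVec w
      have hvs : (vecMulVec (A *ᵥ w) (A *ᵥ w)).PosSemidef := by
        simpa using posSemidef_vecMulVec_self_star (R := ℝ) (A *ᵥ w)
      have h2 := hf_mono _ (t • A) h1 (by rw [sub_sub_cancel]; exact hvs)
      have h3 := hgN (t • A - vecMulVec (A *ᵥ w) (A *ᵥ w))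
      rw [hNs _ (by
        have := h1.1; rwa [IsHermitian, conjTranspose_eq_transpose_of_trivial] at this),
        map_sub, map_smul, hgA, smul_eq_mul] at h3
      rw [hf_hom t ht A hAs] at h2
      linarith
  obtain ⟨C, hC⟩ := hB.exists_eq_transpose_mul_self
  have htr : ∀ X : Matrix n n ℝ, X.IsSymm → (Cᵀᵀ * X * Cᵀ).trace = g X := fun X hX => by
    rw [hgB, hC, hX.eq, transpose_transpose, Matrix.mul_assoc, trace_mul_comm, Matrix.mul_assoc]
  refine ⟨Cᵀ, fun X hX => ?_, ?_⟩
  · rw [htr X hX, ← hNs X hX]; exact hgN X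
  · rw [htr A hAs, hgA]

/-- A bound on a positive monotone homogeneous function of a positive semidefinite matrix controls
its quadratic form. -/
theorem exists_quadratic_bound [Nonempty n] (hf_cont : Continuous f)
    (hf_mono : ∀ X X' : Matrix n n ℝ, X.PosSemidef → (X' - X).PosSemidef → f X ≤ f X')
    (hf_pos : ∀ X : Matrix n n ℝ, X.PosSemidef → X ≠ 0 → 0 < f X)
    (hf_hom : ∀ t : ℝ, 0 < t → ∀ X : Matrix n n ℝ, X.IsSymm → f (t • X) = t * f X) (c : ℝ) :
    ∃ K : ℝ, 0 < K ∧ ∀ M : Matrix n n ℝ, M.PosSemidef → f M ≤ c →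
      ∀ w : EuclideanSpace ℝ n, w.ofLp ⬝ᵥ M *ᵥ w.ofLp ≤ K * ‖w‖ ^ 2 := by
  have hvs : ∀ v : n → ℝ, (vecMulVec v v).PosSemidef := fun v => by
    simpa using posSemidef_vecMulVec_self_star (R := ℝ) v
  have hsy : ∀ {X : Matrix n n ℝ}, X.PosSemidef → X.IsSymm := fun {X} hX => by
    have := hX.1; rwa [IsHermitian, conjTranspose_eq_transpose_of_trivial] at this
  obtain ⟨v₀, hv₀, hmin⟩ := (isCompact_sphere (0 : EuclideanSpace ℝ n) 1).exists_isMinOn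
    (NormedSpace.sphere_nonempty.2 zero_le_one)
    (f := fun v : EuclideanSpace ℝ n => f (vecMulVec v.ofLp v.ofLp))
    (by
      refine (hf_cont.comp ?_).continuousOn
      refine continuous_matrix fun i j => ?_
      simp only [vecMulVec_apply]; fun_prop)
  set c₀ := f (vecMulVec v₀.ofLp v₀.ofLp) with hc₀
  have hc₀pos : 0 < c₀ := by
    refine hf_pos _ (hvs _) fun h => ?_
    have hv : v₀ ≠ 0 := ne_zero_of_mem_unit_sphere ⟨v₀, hv₀⟩
    apply hv
    ext i
    have := congrFun (congrFun h i) i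
    simpa [vecMulVec_apply] using this
  have hlow : ∀ z : EuclideanSpace ℝ n, z ≠ 0 → ‖z‖ ^ 2 * c₀ ≤ f (vecMulVec z.ofLp z.ofLp) := by
    intro z hz
    have hz' : 0 < ‖z‖ := norm_pos_iff.2 hz
    have h1 := hmin (show ‖z‖⁻¹ • z ∈ Metric.sphere (0 : EuclideanSpace ℝ n) 1 by
      simp [norm_smul, hz'.ne'])
    simp only [Set.mem_ofPred_eq] at h1
    have h2 : vecMulVec z.ofLp z.ofLp = ‖z‖ ^ 2 • vecMulVec (‖z‖⁻¹ • z).ofLp (‖z‖⁻¹ • z).ofLp := by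
      ext i j
      simp [vecMulVec_apply]
      field_simp
    rw [h2, hf_hom _ (by positivity) _ (hsy (hvs _))]
    exact mul_le_mul_of_nonneg_left h1 (by positivity)
  refine ⟨max c 1 / c₀, by positivity, fun M hM hc w => ?_⟩
  set q := w.ofLp ⬝ᵥ M *ᵥ w.ofLp with hq
  have hq0 : 0 ≤ q := by simpa using hM.dotProduct_mulVec_nonneg w.ofLp
  rcases hq0.eq_or_lt with h0 | hqpos
  · rw [← h0]; positivity
  set z : EuclideanSpace ℝ n := WithLp.toLp 2 (M *ᵥ w.ofLp) with hz
  have hqin : q = ⟪z, w⟫ := by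
    rw [EuclideanSpace.inner_eq_star_dotProduct]; simp [hq, hz]
  have hCS : q ≤ ‖z‖ * ‖w‖ := hqin ▸ real_inner_le_norm z w
  have hzne : z ≠ 0 := fun h => by rw [hqin, h, inner_zero_left] at hqpos; exact hqpos.ne rfl
  have h3 := hf_mono _ _ (hvs (M *ᵥ w.ofLp)) (hM.smul_sub_vecMulVec w.ofLp)
  rw [hf_hom q hqpos M (hsy hM)] at h3
  have h4 := (hlow z hzne).trans h3
  have h5 : ‖z‖ ^ 2 * c₀ ≤ q * max c 1 :=
    h4.trans (mul_le_mul_of_nonneg_left (hc.trans (le_max_left _ _)) hq0)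
  have h6 : q ^ 2 ≤ ‖z‖ ^ 2 * ‖w‖ ^ 2 := by
    rw [← mul_pow]; exact pow_le_pow_left₀ hq0 hCS 2
  have h7 : q * (q * c₀) ≤ q * (max c 1 * ‖w‖ ^ 2) := by
    nlinarith [mul_le_mul_of_nonneg_right h5 (sq_nonneg ‖w‖),
      mul_le_mul_of_nonneg_right h6 hc₀pos.le]
  rw [div_mul_eq_mul_div, le_div_iff₀ hc₀pos]
  exact le_of_mul_le_mul_left h7 hqpos

end GoodFunction

section ConvexGradient

variable {E : Type*} [NormedAddCommGroup E] [NormedSpace ℝ E] {F : E → ℝ}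

theorem ConvexOn.add_fderiv_le (hF : ConvexOn ℝ Set.univ F) {x : E}
    (hx : DifferentiableAt ℝ F x) (y : E) : F x + fderiv ℝ F x (y - x) ≤ F y := by
  have hg : ConvexOn ℝ Set.univ (fun t : ℝ => F (AffineMap.lineMap x y t)) := by
    exact hF.comp_affineMap (AffineMap.lineMap x y : ℝ →ᵃ[ℝ] E)
  have hd : HasDerivAt (fun t : ℝ => F (AffineMap.lineMap x y t)) (fderiv ℝ F x (y - x)) 0 := by
    have h1 : HasFDerivAt F (fderiv ℝ F x) (AffineMap.lineMap x y (0 : ℝ)) := by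
      simpa using hx.hasFDerivAt
    exact h1.comp_hasDerivAt 0 AffineMap.hasDerivAt_lineMap
  have := hg.le_slope_of_hasDerivAt (Set.mem_univ 0) (Set.mem_univ 1) one_pos hd
  simp only [slope_def_field, AffineMap.lineMap_apply_zero, AffineMap.lineMap_apply_one, sub_zero,
    div_one] at this
  linarith

theorem ConvexOn.fderiv_sub_nonneg (hF : ConvexOn ℝ Set.univ F) (hd : Differentiable ℝ F)
    (x y : E) : 0 ≤ (fderiv ℝ F y - fderiv ℝ F x) (y - x) := by
  have h1 := hF.add_fderiv_le (hd x) y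
  have h2 := hF.add_fderiv_le (hd y) x
  rw [← neg_sub y x, map_neg] at h2
  rw [_root_.sub_apply]
  linarith

theorem hasDerivAt_fderiv_line (hF : ContDiff ℝ 2 F) (x u v : E) (t : ℝ) :
    HasDerivAt (fun s : ℝ => fderiv ℝ F (x + s • u) v)
      (fderiv ℝ (fderiv ℝ F) (x + t • u) u v) t := by
  have h1 : HasFDerivAt (fderiv ℝ F) (fderiv ℝ (fderiv ℝ F) (x + t • u)) (x + t • u) :=
    ((hF.fderiv_right (m := 1) le_rfl).differentiable one_ne_zero _).hasFDerivAt
  have h2 : HasDerivAt (fun s : ℝ => x + s • u) u t := by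
    simpa using ((hasDerivAt_id t).smul_const u).const_add x
  exact (ContinuousLinearMap.apply ℝ ℝ v).hasFDerivAt.comp_hasDerivAt t (h1.comp_hasDerivAt t h2)

theorem ConvexOn.monotone_fderiv_line (hF : ConvexOn ℝ Set.univ F) (hd : Differentiable ℝ F)
    (x u : E) : Monotone (fun s : ℝ => fderiv ℝ F (x + s • u) u) := by
  intro s t hst
  rcases hst.eq_or_lt with rfl | hst
  · rfl
  have h := hF.fderiv_sub_nonneg hd (x + s • u) (x + t • u)
  rw [add_sub_add_left_eq_sub, ← sub_smul, map_smul, smul_eq_mul] at h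
  have := nonneg_of_mul_nonneg_right h (sub_pos.2 hst)
  simpa using this

theorem ConvexOn.fderiv_fderiv_nonneg (hF : ConvexOn ℝ Set.univ F) (hc : ContDiff ℝ 2 F)
    (x u : E) : 0 ≤ fderiv ℝ (fderiv ℝ F) x u u := by
  have h := hasDerivAt_fderiv_line hc x u u 0
  have := (hF.monotone_fderiv_line (hc.differentiable two_ne_zero) x u).deriv_nonneg (x := 0)
  rw [h.deriv] at this
  simpa using this

theorem ConvexOn.eq_of_fderiv_eq (hF : ConvexOn ℝ Set.univ F) (hc : ContDiff ℝ 2 F) {x y : E}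
    (hx : ∀ u, u ≠ 0 → fderiv ℝ (fderiv ℝ F) x u u ≠ 0) (h : fderiv ℝ F x = fderiv ℝ F y) :
    x = y := by
  by_contra hne
  refine hx (y - x) (sub_ne_zero.2 (Ne.symm hne)) ?_
  have hm := hF.monotone_fderiv_line (hc.differentiable two_ne_zero) x (y - x)
  have hd := (hasDerivAt_fderiv_line hc x (y - x) (y - x) 0).hasDerivWithinAt (s := Set.Ici 0)
  rw [zero_smul, add_zero] at hd
  refine (uniqueDiffWithinAt_Ici (0 : ℝ)).eq_deriv _ hd ?_
  refine (hasDerivWithinAt_const (0 : ℝ) (Set.Ici 0) (fderiv ℝ F x (y - x))).congr_of_eventuallyEq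
    ?_ (by simp)
  filter_upwards [inter_mem_nhdsWithin (Set.Ici (0 : ℝ)) (Iio_mem_nhds one_pos)] with t ht
  apply le_antisymm
  · have := hm (le_of_lt ht.2)
    simp only [one_smul, add_sub_cancel] at this
    rwa [← h] at this
  · simpa using hm ht.1

end ConvexGradient

section Gradient

variable {E : Type*} [NormedAddCommGroup E] [InnerProductSpace ℝ E] [CompleteSpace E] {F : E → ℝ}

theorem contDiff_gradient (hF : ContDiff ℝ 2 F) : ContDiff ℝ 1 (gradient F) :=
  (InnerProductSpace.toDual ℝ E).symm.contDiff.comp (hF.fderiv_right (m := 1) le_rfl)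

theorem inner_fderiv_gradient (hF : ContDiff ℝ 2 F) (x u v : E) :
    ⟪fderiv ℝ (gradient F) x u, v⟫ = fderiv ℝ (fderiv ℝ F) x u v := by
  have h1 : HasFDerivAt (fun z => ⟪gradient F z, v⟫)
      ((innerSL ℝ v).comp (fderiv ℝ (gradient F) x)) x := by
    simp_rw [real_inner_comm v]
    exact (innerSL ℝ v).hasFDerivAt.comp x
      ((contDiff_gradient hF).differentiable one_ne_zero x).hasFDerivAt
  have h2 : HasFDerivAt (fun z => fderiv ℝ F z v) _ x :=
    ((hF.fderiv_right (m := 1) le_rfl).differentiable one_ne_zero x).hasFDerivAt.clm_apply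
      (hasFDerivAt_const v x)
  simp_rw [inner_gradient_left] at h1
  have := congrArg (fun M => M u) (h1.unique h2)
  simpa [real_inner_comm] using this

end Gradient

section ChangeOfVariables

variable {E : Type*} [NormedAddCommGroup E] [NormedSpace ℝ E] [FiniteDimensional ℝ E]
  [MeasurableSpace E] [BorelSpace E]

/-- A map that is injective off its critical set and pushes `e^{-V}` to `e^{-W}` satisfies the
change of variables equation. -/
theorem exp_neg_eq_of_map_eq {vol : Measure E} [vol.IsAddHaarMeasure] {T : E → E}
    {A : E → E →L[ℝ] E} (hT : ∀ x, HasFDerivAt T (A x) x) (hA : Continuous A)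
    (hinj : ∀ x y, (A x).det ≠ 0 → T x = T y → x = y) {V W : E → ℝ} (hV : Continuous V)
    (hW : Continuous W)
    (hmap : Measure.map T (vol.withDensity fun x => ENNReal.ofReal (Real.exp (-V x))) =
      vol.withDensity fun x => ENNReal.ofReal (Real.exp (-W x))) (x : E) :
    Real.exp (-V x) = |(A x).det| * Real.exp (-W (T x)) := by
  have hTc : Continuous T := continuous_iff_continuousAt.2 fun x => (hT x).continuousAt
  have hdet : Continuous fun x => (A x).det := ContinuousLinearMap.continuous_det.comp hA
  set Z : Set E := {x | (A x).det = 0}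
  have hZ : MeasurableSet Z := (isClosed_singleton.preimage hdet).measurableSet
  have hVm : Measurable fun x => ENNReal.ofReal (Real.exp (-V x)) := by fun_prop
  have hWm : Measurable fun x => ENNReal.ofReal (Real.exp (-W x)) := by fun_prop
  have hZ0 : vol Z = 0 := by
    have h1 : vol (T '' Z) = 0 := addHaar_image_eq_zero_of_det_fderivWithin_eq_zero vol
      (fun x _ => (hT x).hasFDerivWithinAt) (fun x hx => hx)
    have h2 := withDensity_absolutelyContinuous vol (fun x => ENNReal.ofReal (Real.exp (-W x))) h1
    rw [← hmap] at h2
    have h3 := (Measure.tendsto_ae_map hTc.aemeasurable) (compl_mem_ae_iff.2 h2)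
    have h4 : (vol.withDensity fun x => ENNReal.ofReal (Real.exp (-V x))) Z = 0 := by
      refine measure_mono_null ?_ (compl_mem_ae_iff.1 (by simpa using h3))
      intro z hz
      simpa using ⟨z, hz, rfl⟩
    exact withDensity_absolutelyContinuous' hVm.aemeasurable
      (Eventually.of_forall fun x => by simp [Real.exp_pos]) h4
  have hae : (fun x => ENNReal.ofReal (Real.exp (-V x))) =ᵐ[vol]
      fun x => ENNReal.ofReal |(A x).det| * ENNReal.ofReal (Real.exp (-W (T x))) := by
    refine ae_eq_of_forall_setLIntegral_eq_of_sigmaFinite hVm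
      ((hdet.abs.measurable.ennreal_ofReal).mul (hWm.comp hTc.measurable)) fun U hU _ => ?_
    have hUZ : (U \ Z : Set E) =ᵐ[vol] U := sdiff_null_ae_eq_self hZ0
    rw [← setLIntegral_congr hUZ, ← setLIntegral_congr hUZ]
    have hUm : MeasurableSet (U \ Z) := hU.diff hZ
    have hinjU : Set.InjOn T (U \ Z) := fun a ha b _ hab => hinj a b ha.2 hab
    have hpre : T ⁻¹' (T '' (U \ Z)) = U \ Z := by
      refine Set.Subset.antisymm ?_ (Set.subset_preimage_image _ _)
      rintro y ⟨a, ha, hay⟩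
      rwa [← hinj a y ha.2 hay]
    have him : MeasurableSet (T '' (U \ Z)) := measurable_image_of_fderivWithin hUm
      (fun x _ => (hT x).hasFDerivWithinAt) hinjU
    rw [← lintegral_image_eq_lintegral_abs_det_fderiv_mul vol hUm
      (fun x _ => (hT x).hasFDerivWithinAt) hinjU
      (fun x => ENNReal.ofReal (Real.exp (-W x))),
      ← withDensity_apply _ him, ← hmap, Measure.map_apply hTc.measurable him, hpre,
      withDensity_apply _ hUm]
  have hc := (Continuous.ae_eq_iff_eq vol
    (ENNReal.continuous_ofReal.comp (Real.continuous_exp.comp hV.neg)) ?_).1 hae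
  · have := congrArg ENNReal.toReal (congrFun hc x)
    simpa [ENNReal.toReal_ofReal, (Real.exp_pos _).le] using this
  · simp_rw [← ENNReal.ofReal_mul (abs_nonneg _)]
    exact ENNReal.continuous_ofReal.comp
      (hdet.abs.mul (Real.continuous_exp.comp (hW.comp hTc).neg))

end ChangeOfVariables

section Coercive

variable {E : Type*} [NormedAddCommGroup E] [InnerProductSpace ℝ E] [FiniteDimensional ℝ E]

/-- The gradient of a finite convex function on a Euclidean space is onto if its range is dense. -/
theorem ConvexOn.gradient_surjective {F : E → ℝ} (hF : ConvexOn ℝ Set.univ F)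
    (hd : Differentiable ℝ F) (hdense : DenseRange (gradient F)) :
    Function.Surjective (gradient F) := by
  intro y
  obtain ⟨t, ht⟩ := (isCompact_sphere (0 : E) 1).elim_finite_subcover
    (fun z : E => Metric.ball (gradient F z - y) (1 / 2)) (fun z => Metric.isOpen_ball)
    (fun u _ => by
      obtain ⟨z, hz⟩ := hdense.exists_mem_open (s := Metric.ball (y + u) (1 / 2))
        Metric.isOpen_ball ⟨y + u, Metric.mem_ball_self (by norm_num)⟩
      refine Set.mem_iUnion.2 ⟨z, ?_⟩
      rw [Metric.mem_ball, dist_eq_norm] at hz ⊢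
      rwa [← norm_neg, show -(u - (gradient F z - y)) = gradient F z - (y + u) by abel])
  obtain ⟨m, hm⟩ : ∃ m : ℝ, ∀ z ∈ t, m ≤ F z - ⟪gradient F z, z⟫ := by
    obtain ⟨m, hm⟩ := (t.finite_toSet.image fun z => F z - ⟪gradient F z, z⟫).bddBelow
    exact ⟨m, fun z hz => hm ⟨z, hz, rfl⟩⟩
  have hlow : ∀ x : E, x ≠ 0 → m + 1 / 2 * ‖x‖ ≤ F x - ⟪y, x⟫ := by
    intro x hx
    have hx' : 0 < ‖x‖ := norm_pos_iff.2 hx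
    have hu : ‖x‖⁻¹ • x ∈ Metric.sphere (0 : E) 1 := by simp [norm_smul, hx'.ne']
    obtain ⟨z, hz, hzu⟩ := Set.mem_iUnion₂.1 (ht hu)
    rw [Metric.mem_ball, dist_eq_norm] at hzu
    have h1 := hF.add_fderiv_le (hd z) x
    rw [← inner_gradient_left, inner_sub_right] at h1
    have h2 := hm z hz
    have h3 := real_inner_le_norm (‖x‖⁻¹ • x - (gradient F z - y)) x
    rw [inner_sub_left, inner_sub_left, real_inner_smul_left, real_inner_self_eq_norm_sq] at h3
    have h4 : ‖x‖⁻¹ * ‖x‖ ^ 2 = ‖x‖ := by field_simp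
    have h5 := mul_le_mul_of_nonneg_right hzu.le hx'.le
    linarith
  have hcont : Continuous fun x => F x - ⟪y, x⟫ :=
    hd.continuous.sub (continuous_const.inner continuous_id)
  have htend : Tendsto (fun x => F x - ⟪y, x⟫) (cocompact E) atTop := by
    have h1 : Tendsto (fun x : E => m + 1 / 2 * ‖x‖) (cocompact E) atTop :=
      tendsto_atTop_add_const_left _ _
        ((tendsto_norm_cocompact_atTop (E := E)).const_mul_atTop (by norm_num))
    refine tendsto_atTop_mono' _ ?_ h1
    filter_upwards [(isCompact_singleton (x := (0 : E))).compl_mem_cocompact] with x hx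
    exact hlow x hx
  obtain ⟨x, hx⟩ := hcont.exists_forall_le htend
  refine ⟨x, ext_inner_right ℝ fun v => ?_⟩
  have hmin : IsLocalMin (fun x => F x - ⟪y, x⟫) x := Eventually.of_forall hx
  have hder : HasFDerivAt (fun x => F x - ⟪y, x⟫) (fderiv ℝ F x - innerSL ℝ y) x :=
    (hd x).hasFDerivAt.sub (innerSL ℝ y).hasFDerivAt
  have := congrArg (fun M => M v) (hmin.hasFDerivAt_eq_zero hder)
  simp only [_root_.sub_apply, innerSL_apply_apply, _root_.zero_apply] at this
  rw [inner_gradient_left]; linarith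

end Coercive

section Hessian

variable {d : ℕ}

local notation "𝔼" => EuclideanSpace ℝ (Fin d)

theorem hessianMatrix_apply (F : 𝔼 → ℝ) (x : 𝔼) (i j : Fin d) :
    hessianMatrix F x i j = fderiv ℝ (fderiv ℝ F) x (EuclideanSpace.single i 1)
      (EuclideanSpace.single j 1) := by
  simp [hessianMatrix, iteratedFDeriv_two_apply]

theorem fderiv_fderiv_symm {F : 𝔼 → ℝ} (hF : ContDiff ℝ 2 F) (x u v : 𝔼) :
    fderiv ℝ (fderiv ℝ F) x u v = fderiv ℝ (fderiv ℝ F) x v u :=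
  (hF.contDiffAt.isSymmSndFDerivAt (by simp)).eq u v

theorem hessianMatrix_isSymm {F : 𝔼 → ℝ} (hF : ContDiff ℝ 2 F) (x : 𝔼) :
    (hessianMatrix F x).IsSymm := by
  ext i j
  rw [transpose_apply, hessianMatrix_apply, hessianMatrix_apply, fderiv_fderiv_symm hF]

theorem toEuclideanCLM_hessianMatrix {F : 𝔼 → ℝ} (hF : ContDiff ℝ 2 F) (x : 𝔼) :
    toEuclideanCLM (𝕜 := ℝ) (hessianMatrix F x) = fderiv ℝ (gradient F) x := by
  refine ContinuousLinearMap.coe_injective ((EuclideanSpace.basisFun (Fin d) ℝ).toBasis.ext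
    fun j => ?_)
  ext i
  have := inner_fderiv_gradient hF x (EuclideanSpace.single j 1) (EuclideanSpace.single i 1)
  rw [EuclideanSpace.inner_single_right] at this
  simp only [OrthonormalBasis.coe_toBasis, EuclideanSpace.basisFun_apply,
    ContinuousLinearMap.coe_coe, ofLp_toEuclideanCLM]
  simp only [PiLp.ofLp_single, mulVec_single_one, col_apply, hessianMatrix_apply]
  rw [fderiv_fderiv_symm hF, ← this]
  simp

theorem dotProduct_hessianMatrix_mulVec {F : 𝔼 → ℝ} (hF : ContDiff ℝ 2 F) (x u v : 𝔼) :
    u.ofLp ⬝ᵥ hessianMatrix F x *ᵥ v.ofLp = fderiv ℝ (fderiv ℝ F) x u v := by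
  rw [← inner_toEuclideanCLM, toEuclideanCLM_hessianMatrix hF, real_inner_comm,
    inner_fderiv_gradient hF, fderiv_fderiv_symm hF]

theorem det_fderiv_gradient {F : 𝔼 → ℝ} (hF : ContDiff ℝ 2 F) (x : 𝔼) :
    (fderiv ℝ (gradient F) x).det = (hessianMatrix F x).det := by
  rw [← toEuclideanCLM_hessianMatrix hF]
  exact LinearMap.det_toLpLin _ _

theorem posSemidef_hessianMatrix {F : 𝔼 → ℝ} (hF : ContDiff ℝ 2 F)
    (hconv : ConvexOn ℝ Set.univ F) (x : 𝔼) : (hessianMatrix F x).PosSemidef := by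
  refine PosSemidef.of_dotProduct_mulVec_nonneg ?_ fun v => ?_
  · rw [IsHermitian, conjTranspose_eq_transpose_of_trivial]
    exact hessianMatrix_isSymm hF x
  · have := dotProduct_hessianMatrix_mulVec hF x (WithLp.toLp 2 v) (WithLp.toLp 2 v)
    rw [star_trivial]
    exact this ▸ hconv.fderiv_fderiv_nonneg hF x _

theorem weightedLaplacian_toEuclideanCLM {F : 𝔼 → ℝ} (hF : ContDiff ℝ 2 F)
    (C : Matrix (Fin d) (Fin d) ℝ) (x : 𝔼) :
    weightedLaplacian (toEuclideanCLM (𝕜 := ℝ) C) F x = (Cᵀ * hessianMatrix F x * C).trace := by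
  simp only [weightedLaplacian, trace, diag_apply]
  refine Finset.sum_congr rfl fun i _ => ?_
  rw [← dotProduct_hessianMatrix_mulVec hF, ofLp_toEuclideanCLM, PiLp.ofLp_single,
    mulVec_single_one, Matrix.mul_assoc]
  simp [mul_apply, dotProduct, mulVec]

/-- Structure of the Brenier map between two measures with continuous positive densities. -/
theorem brenier_structure {V W φ : 𝔼 → ℝ} (hV : Continuous V) (hW : Continuous W)
    (hφ : ContDiff ℝ 2 φ) (hconv : ConvexOn ℝ Set.univ φ)
    (hmap : Measure.map (gradient φ)
      (volume.withDensity fun x => ENNReal.ofReal (Real.exp (-V x))) =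
      volume.withDensity fun x => ENNReal.ofReal (Real.exp (-W x))) :
    (∀ x, (hessianMatrix φ x).PosDef) ∧
    (∀ x, V x = W (gradient φ x) - Real.log (hessianMatrix φ x).det) ∧
    ∃ S : 𝔼 → 𝔼, ContDiff ℝ 1 S ∧ (∀ x, S (gradient φ x) = x) ∧ ∀ y, gradient φ (S y) = y := by
  have hT : ∀ x, HasFDerivAt (gradient φ) (fderiv ℝ (gradient φ) x) x := fun x =>
    ((contDiff_gradient hφ).differentiable one_ne_zero x).hasFDerivAt
  have hpsd := posSemidef_hessianMatrix hφ hconv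
  have hinj : ∀ x y, (fderiv ℝ (gradient φ) x).det ≠ 0 → gradient φ x = gradient φ y →
      x = y := by
    intro x y hx hxy
    refine hconv.eq_of_fderiv_eq hφ (fun u hu h0 => hu ?_)
      ((InnerProductSpace.toDual ℝ _).symm.injective hxy)
    rw [det_fderiv_gradient hφ] at hx
    have hpd := (hpsd x).posDef_iff_det_ne_zero.2 hx
    by_contra
    have := hpd.dotProduct_mulVec_pos (x := u.ofLp) (by simpa using hu)
    rw [star_trivial, dotProduct_hessianMatrix_mulVec hφ, h0] at this
    exact this.ne rfl
  have hMA := exp_neg_eq_of_map_eq hT ((contDiff_gradient hφ).continuous_fderiv one_ne_zero)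
    hinj hV hW hmap
  simp_rw [det_fderiv_gradient hφ] at hMA hinj
  have hdet : ∀ x, 0 < (hessianMatrix φ x).det := fun x =>
    (hpsd x).det_nonneg.lt_of_ne fun h => by
      have := hMA x
      rw [← h, abs_zero, zero_mul] at this
      exact (Real.exp_pos _).ne' this
  have hsurj : Function.Surjective (gradient φ) := by
    refine hconv.gradient_surjective (hφ.differentiable two_ne_zero)
      (dense_iff_inter_open.2 fun U hU hUne => ?_)
    by_contra hemp
    have h1 : (gradient φ) ⁻¹' U = ∅ := by
      rw [Set.not_nonempty_iff_eq_empty] at hemp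
      rw [← Set.preimage_inter_range, hemp, Set.preimage_empty]
    have h2 : (volume.withDensity fun x => ENNReal.ofReal (Real.exp (-W x))) U = 0 := by
      rw [← hmap, Measure.map_apply (contDiff_gradient hφ).continuous.measurable hU.measurableSet,
        h1, measure_empty]
    have h3 := withDensity_absolutelyContinuous' (μ := (volume : Measure 𝔼))
      (f := fun x => ENNReal.ofReal (Real.exp (-W x))) (by fun_prop)
      (Eventually.of_forall fun x => by simp [Real.exp_pos]) h2
    exact hU.measure_ne_zero volume hUne h3
  refine ⟨fun x => (hpsd x).posDef_iff_det_ne_zero.2 (hdet x).ne', fun x => ?_, ?_⟩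
  · have h := congrArg Real.log (hMA x)
    rw [Real.log_exp, abs_of_pos (hdet x), Real.log_mul (hdet x).ne' (Real.exp_pos _).ne',
      Real.log_exp] at h
    linarith
  · have hdet' : ∀ x, (fderiv ℝ (gradient φ) x).det ≠ 0 := fun x => by
      rw [det_fderiv_gradient hφ]; exact (hdet x).ne'
    let A : 𝔼 → 𝔼 ≃L[ℝ] 𝔼 := fun x =>
      (fderiv ℝ (gradient φ) x).toContinuousLinearEquivOfDetNeZero (hdet' x)
    have hopen : IsOpenMap (gradient φ) :=
      isOpenMap_of_hasStrictFDerivAt_equiv (f' := A) fun x =>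
        (contDiff_gradient hφ).contDiffAt.hasStrictFDerivAt one_ne_zero
    let e := (Equiv.ofBijective (gradient φ) ⟨fun x y h => hinj x y (hdet x).ne' h,
      hsurj⟩).toHomeomorphOfContinuousOpen (contDiff_gradient hφ).continuous hopen
    exact ⟨e.symm, e.contDiff_symm (f₀' := A) hT (contDiff_gradient hφ), e.symm_apply_apply,
      e.apply_symm_apply⟩

end Hessian

section Legendre

variable {E : Type*} [NormedAddCommGroup E] [InnerProductSpace ℝ E] {W Wstar : E → ℝ}

theorem convexOn_of_isLUB_legendre
    (h : ∀ y, IsLUB {z : ℝ | ∃ x : E, z = ⟪x, y⟫ - W x} (Wstar y)) :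
    ConvexOn ℝ Set.univ Wstar := by
  refine ⟨convex_univ, fun y _ z _ a b ha hb hab => (h _).2 ?_⟩
  rintro _ ⟨x, rfl⟩
  have h1 := mul_le_mul_of_nonneg_left ((h y).1 ⟨x, rfl⟩) ha
  have h2 := mul_le_mul_of_nonneg_left ((h z).1 ⟨x, rfl⟩) hb
  rw [inner_add_right, real_inner_smul_right, real_inner_smul_right, smul_eq_mul, smul_eq_mul]
  have h3 : W x = a * W x + b * W x := by rw [← add_mul, hab, one_mul]
  linarith

theorem le_add_quadratic_of_fderiv_fderiv_le {F : E → ℝ} (hF : ContDiff ℝ 2 F) {K : ℝ}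
    (hK : ∀ x u, fderiv ℝ (fderiv ℝ F) x u u ≤ K * ‖u‖ ^ 2) (x u : E) :
    F (x + u) ≤ F x + fderiv ℝ F x u + K / 2 * ‖u‖ ^ 2 := by
  have hd1 : ∀ s, HasDerivAt (fun s : ℝ => fderiv ℝ F (x + s • u) u - K * ‖u‖ ^ 2 * s)
      (fderiv ℝ (fderiv ℝ F) (x + s • u) u u - K * ‖u‖ ^ 2) s := fun s => by
    simpa using (hasDerivAt_fderiv_line hF x u u s).fun_sub
      ((hasDerivAt_id s).const_mul (K * ‖u‖ ^ 2))
  have hanti : Antitone (fun s : ℝ => fderiv ℝ F (x + s • u) u - K * ‖u‖ ^ 2 * s) :=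
    antitone_of_deriv_nonpos (fun s => (hd1 s).differentiableAt) fun s => by
      rw [(hd1 s).deriv]; linarith [hK (x + s • u) u]
  have hd2 : ∀ s, HasDerivAt (fun s : ℝ => F (x + s • u) - fderiv ℝ F x u * s
      - K / 2 * ‖u‖ ^ 2 * s ^ 2) (fderiv ℝ F (x + s • u) u - fderiv ℝ F x u
      - K * ‖u‖ ^ 2 * s) s := fun s => by
    have h2 : HasDerivAt (fun s : ℝ => x + s • u) u s := by
      simpa using ((hasDerivAt_id s).smul_const u).const_add x
    have h1 := (hF.differentiable two_ne_zero (x + s • u)).hasFDerivAt.comp_hasDerivAt s h2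
    refine ((h1.fun_sub ((hasDerivAt_id s).const_mul (fderiv ℝ F x u))).fun_sub
      ((hasDerivAt_pow 2 s).const_mul (K / 2 * ‖u‖ ^ 2))).congr_deriv ?_
    simp only [mul_one, Nat.cast_ofNat, Nat.add_one_sub_one, pow_one]; ring
  have hmv : AntitoneOn (fun s : ℝ => F (x + s • u) - fderiv ℝ F x u * s
      - K / 2 * ‖u‖ ^ 2 * s ^ 2) (Set.Ici 0) := by
    refine antitoneOn_of_deriv_nonpos (convex_Ici 0)
      (fun s _ => (hd2 s).continuousAt.continuousWithinAt)
      (fun s _ => (hd2 s).differentiableAt.differentiableWithinAt) fun s hs => ?_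
    rw [interior_Ici] at hs
    have := hanti (le_of_lt hs)
    simp only [zero_smul, add_zero, mul_zero, sub_zero] at this
    rw [(hd2 s).deriv]; linarith
  have := hmv (Set.mem_Ici.2 le_rfl) (Set.mem_Ici.2 zero_le_one) zero_le_one
  simp only [one_smul, zero_smul, add_zero] at this
  linarith

variable [CompleteSpace E]

theorem legendre_gradient
    (hleg : ∀ y, IsLUB {z : ℝ | ∃ x : E, z = ⟪x, y⟫ - W x} (Wstar y))
    (hW : ConvexOn ℝ Set.univ W) (hd : Differentiable ℝ W)
    (y : E) : Wstar (gradient W y) = ⟪y, gradient W y⟫ - W y := by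
  refine (hleg _).unique (IsGreatest.isLUB ⟨⟨y, rfl⟩, ?_⟩)
  rintro _ ⟨x, rfl⟩
  have := hW.add_fderiv_le (hd y) x
  rw [← inner_gradient_left, inner_sub_right] at this
  rw [real_inner_comm, real_inner_comm _ y]; linarith

/-- The Bregman divergence of `W` is bounded below by increments of the Legendre transform. -/
theorem inner_sub_legendre_le_bregman
    (hleg : ∀ y, IsLUB {z : ℝ | ∃ x : E, z = ⟪x, y⟫ - W x} (Wstar y))
    (hW : ConvexOn ℝ Set.univ W) (hd : Differentiable ℝ W)
    (y z q : E) :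
    ⟪z, q⟫ - (Wstar (gradient W y + q) - Wstar (gradient W y)) ≤
      W z - W y - ⟪gradient W y, z - y⟫ := by
  have h1 := (hleg (gradient W y + q)).1 ⟨z, rfl⟩
  rw [inner_add_right] at h1
  rw [legendre_gradient hleg hW hd y, inner_sub_right, real_inner_comm z (gradient W y),
    real_inner_comm y (gradient W y)]
  linarith

theorem fderiv_legendre_gradient
    (hleg : ∀ y, IsLUB {z : ℝ | ∃ x : E, z = ⟪x, y⟫ - W x} (Wstar y))
    (hW : ConvexOn ℝ Set.univ W) (hd : Differentiable ℝ W)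
    (hds : Differentiable ℝ Wstar) (y q : E) :
    fderiv ℝ Wstar (gradient W y) q = ⟪y, q⟫ := by
  have hmin : IsLocalMin (fun p => Wstar p - ⟪y, p⟫) (gradient W y) :=
    Eventually.of_forall fun p => by
      simp only
      rw [legendre_gradient hleg hW hd y]
      linarith [(hleg p).1 ⟨y, rfl⟩]
  have := congrArg (fun M => M q) (hmin.hasFDerivAt_eq_zero
    ((hds (gradient W y)).hasFDerivAt.sub (innerSL ℝ y).hasFDerivAt))
  simp only [_root_.sub_apply, innerSL_apply_apply, _root_.zero_apply] at this
  linarith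

theorem sq_norm_sub_le_bregman
    (hleg : ∀ y, IsLUB {z : ℝ | ∃ x : E, z = ⟪x, y⟫ - W x} (Wstar y))
    (hW : ConvexOn ℝ Set.univ W) (hd : Differentiable ℝ W)
    (hs : ContDiff ℝ 2 Wstar) {K : ℝ} (hK0 : 0 < K)
    (hK : ∀ x u, fderiv ℝ (fderiv ℝ Wstar) x u u ≤ K * ‖u‖ ^ 2) (y z : E) :
    ‖z - y‖ ^ 2 / (2 * K) ≤ W z - W y - ⟪gradient W y, z - y⟫ := by
  have h1 := inner_sub_legendre_le_bregman hleg hW hd y z (K⁻¹ • (z - y))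
  have h2 := le_add_quadratic_of_fderiv_fderiv_le hs hK (gradient W y) (K⁻¹ • (z - y))
  rw [fderiv_legendre_gradient hleg hW hd (hs.differentiable two_ne_zero)] at h2
  have h3 : ⟪z, K⁻¹ • (z - y)⟫ - ⟪y, K⁻¹ • (z - y)⟫ = K⁻¹ * ‖z - y‖ ^ 2 := by
    rw [← inner_sub_left, real_inner_smul_right, real_inner_self_eq_norm_sq]
  have h4 : K / 2 * ‖K⁻¹ • (z - y)‖ ^ 2 = ‖z - y‖ ^ 2 / (2 * K) := by
    rw [norm_smul, mul_pow, Real.norm_eq_abs, sq_abs]; field_simp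
  have h5 : K⁻¹ * ‖z - y‖ ^ 2 = 2 * (‖z - y‖ ^ 2 / (2 * K)) := by field_simp
  linarith

end Legendre

section Divergence

variable {d : ℕ}

local notation "𝔼" => EuclideanSpace ℝ (Fin d)

/-- The divergence of a vector field on Euclidean space. -/
noncomputable def divergence (Y : 𝔼 → 𝔼) (y : 𝔼) : ℝ :=
  ∑ i, fderiv ℝ Y y (EuclideanSpace.single i 1) i

theorem continuous_divergence {Y : 𝔼 → 𝔼} (hY : ContDiff ℝ 1 Y) : Continuous (divergence Y) := by
  have := hY.continuous_fderiv one_ne_zero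
  unfold divergence
  fun_prop

theorem hasCompactSupport_divergence {Y : 𝔼 → 𝔼} (hYc : HasCompactSupport Y) :
    HasCompactSupport (divergence Y) := by
  refine (hYc.fderiv ℝ).mono fun y hy hfd => hy ?_
  simp [divergence, hfd]

theorem integral_divergence_eq_zero {Y : 𝔼 → 𝔼} (hY : ContDiff ℝ 1 Y)
    (hYc : HasCompactSupport Y) : ∫ y, divergence Y y = 0 := by
  have hc := hY.continuous_fderiv one_ne_zero
  have hfc := hYc.fderiv (𝕜 := ℝ)
  have hi : ∀ i : Fin d, Integrable fun y => fderiv ℝ Y y (EuclideanSpace.single i 1) i :=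
    fun i => Continuous.integrable_of_hasCompactSupport (by fun_prop)
      (hfc.mono fun y hy hfd => hy (by simp [hfd]))
  unfold divergence
  rw [integral_finsetSum _ fun i _ => hi i]
  refine Finset.sum_eq_zero fun i _ => ?_
  have hYi : ∀ y, HasFDerivAt (fun z => Y z i) ((EuclideanSpace.proj i).comp (fderiv ℝ Y y)) y :=
    fun y => (EuclideanSpace.proj i : 𝔼 →L[ℝ] ℝ).hasFDerivAt.comp y
      (hY.differentiable one_ne_zero y).hasFDerivAt
  have hd : ∀ y v, fderiv ℝ (fun z => Y z i) y v = fderiv ℝ Y y v i := fun y v => by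
    rw [(hYi y).fderiv]; rfl
  have := integral_mul_fderiv_eq_neg_fderiv_mul_of_integrable (μ := (volume : Measure 𝔼))
    (f := fun _ => (1 : ℝ)) (g := fun z => Y z i) (v := EuclideanSpace.single i 1)
    (by simp) (by simpa [hd] using hi i)
    (by
      simp only [one_mul]
      exact (by fun_prop : Continuous fun z => Y z i).integrable_of_hasCompactSupport
        (hYc.mono fun y hy h0 => hy (by simp [h0])))
    (by fun_prop) (fun y _ => (hYi y).differentiableAt)
  simpa [hd] using this

theorem divergence_smul {q : 𝔼 → ℝ} {Y : 𝔼 → 𝔼} {y : 𝔼} (hq : DifferentiableAt ℝ q y)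
    (hY : DifferentiableAt ℝ Y y) :
    divergence (fun z => q z • Y z) y = q y * divergence Y y + fderiv ℝ q y (Y y) := by
  have h := hq.hasFDerivAt.smul hY.hasFDerivAt
  have hsum : Y y = ∑ i, Y y i • EuclideanSpace.single i (1 : ℝ) := by
    simpa using ((EuclideanSpace.basisFun (Fin d) ℝ).sum_repr (Y y)).symm
  have hfd : fderiv ℝ (fun z => q z • Y z) y = _ := h.fderiv
  conv_rhs => rw [hsum]
  rw [map_sum, divergence, hfd, divergence, Finset.mul_sum, ← Finset.sum_add_distrib]
  refine Finset.sum_congr rfl fun i _ => ?_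
  simp [mul_comm]

end Divergence

section Displacement

variable {d : ℕ}

local notation "𝔼" => EuclideanSpace ℝ (Fin d)

theorem integrable_averagingWeight_smul {X : Type*} [NormedAddCommGroup X] [NormedSpace ℝ X]
    {f : 𝔼 → X} (hf : Continuous f) : Integrable fun h => averagingWeight h • f h :=
  (continuous_averagingWeight.smul hf).integrable_of_hasCompactSupport
    hasCompactSupport_averagingWeight.smul_right

theorem integrable_averagingWeight_mul {f : 𝔼 → ℝ} (hf : Continuous f) :
    Integrable fun h => averagingWeight h * f h :=
  integrable_averagingWeight_smul hf

theorem ellipsoidAverage_sub_eq (L : 𝔼 →L[ℝ] 𝔼) {F : 𝔼 → ℝ} (hF : Continuous F) (r : ℝ) (x : 𝔼) :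
    ellipsoidAverage L F r x - ellipsoidAverage L F 0 x =
      ∫ h, averagingWeight h * (F (x + r • L h) - F x) := by
  unfold ellipsoidAverage
  rw [← integral_sub (integrable_averagingWeight_mul (by fun_prop))
    (integrable_averagingWeight_mul (by fun_prop))]
  simp [mul_sub]

theorem continuous_hessianMatrix {F : 𝔼 → ℝ} (hF : ContDiff ℝ 2 F) :
    Continuous (hessianMatrix F) := by
  have := (hF.fderiv_right (m := 1) le_rfl).continuous_fderiv one_ne_zero
  refine continuous_matrix fun i j => ?_
  simp_rw [hessianMatrix_apply]
  fun_prop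

/-- The average of the displacements `∇φ(x + r L h) - ∇φ(x)`. -/
noncomputable def averagedDisplacement (L : 𝔼 →L[ℝ] 𝔼) (φ : 𝔼 → ℝ) (r : ℝ) (x : 𝔼) : 𝔼 :=
  ∫ h, averagingWeight h • (gradient φ (x + r • L h) - gradient φ x)

theorem inner_averagedDisplacement (L : 𝔼 →L[ℝ] 𝔼) {φ : 𝔼 → ℝ} (hφ : ContDiff ℝ 2 φ)
    (r : ℝ) (x v : 𝔼) :
    ⟪averagedDisplacement L φ r x, v⟫ =
      ∫ h, averagingWeight h * ⟪gradient φ (x + r • L h) - gradient φ x, v⟫ := by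
  have hc := (contDiff_gradient hφ).continuous
  have := (innerSL ℝ v).integral_comp_comm (integrable_averagingWeight_smul
    (f := fun h => gradient φ (x + r • L h) - gradient φ x) (by fun_prop))
  simp only [innerSL_apply_apply, inner_smul_right] at this
  rw [real_inner_comm, averagedDisplacement, ← this]
  simp_rw [real_inner_comm v]

theorem hasFDerivAt_averagedDisplacement (L : 𝔼 →L[ℝ] 𝔼) {φ : 𝔼 → ℝ} (hφ : ContDiff ℝ 2 φ)
    (r : ℝ) (x : 𝔼) :
    HasFDerivAt (averagedDisplacement L φ r)
      (∫ h, averagingWeight h •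
        (fderiv ℝ (gradient φ) (x + r • L h) - fderiv ℝ (gradient φ) x)) x := by
  have hT := contDiff_gradient hφ
  have hc := hT.continuous
  have hc' := hT.continuous_fderiv one_ne_zero
  refine hasFDerivAt_integral_weight volume continuous_averagingWeight
    hasCompactSupport_averagingWeight
    (F := fun q h => gradient φ (q + r • L h) - gradient φ q)
    (F' := fun q h => fderiv ℝ (gradient φ) (q + r • L h) - fderiv ℝ (gradient φ) q)
    (by fun_prop) (by fun_prop) (fun p h => ?_) x
  have h1 := (hT.differentiable one_ne_zero (p + r • L h)).hasFDerivAt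
  exact ((hasFDerivAt_comp_add_right (r • L h)).2 h1).sub (hT.differentiable one_ne_zero p).hasFDerivAt

theorem contDiff_averagedDisplacement (L : 𝔼 →L[ℝ] 𝔼) {φ : 𝔼 → ℝ} (hφ : ContDiff ℝ 2 φ)
    (r : ℝ) : ContDiff ℝ 1 (averagedDisplacement L φ r) := by
  have hc' := (contDiff_gradient hφ).continuous_fderiv one_ne_zero
  refine contDiff_one_iff_hasFDerivAt.2 ⟨_, ?_, hasFDerivAt_averagedDisplacement L hφ r⟩
  exact continuous_integral_weight volume continuous_averagingWeight
    hasCompactSupport_averagingWeight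
    (F := fun q h => fderiv ℝ (gradient φ) (q + r • L h) - fderiv ℝ (gradient φ) q) (by fun_prop)

theorem hasFDerivAt_ellipsoidAverage_sub (L : 𝔼 →L[ℝ] 𝔼) {φ : 𝔼 → ℝ} (hφ : ContDiff ℝ 2 φ)
    (r : ℝ) (x : 𝔼) :
    HasFDerivAt (fun z => ellipsoidAverage L φ r z - ellipsoidAverage L φ 0 z)
      (innerSL ℝ (averagedDisplacement L φ r x)) x := by
  have hc := hφ.continuous
  have hc' := hφ.continuous_fderiv two_ne_zero
  simp_rw [ellipsoidAverage_sub_eq L hc]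
  have h := hasFDerivAt_integral_weight volume continuous_averagingWeight
    hasCompactSupport_averagingWeight
    (F := fun q h => φ (q + r • L h) - φ q)
    (F' := fun q h => fderiv ℝ φ (q + r • L h) - fderiv ℝ φ q)
    (by fun_prop) (by fun_prop) (fun p h => by
      have h1 := (hφ.differentiable two_ne_zero (p + r • L h)).hasFDerivAt
      exact ((hasFDerivAt_comp_add_right (r • L h)).2 h1).sub (hφ.differentiable two_ne_zero p).hasFDerivAt) x
  simp only [smul_eq_mul] at h
  refine h.congr_fderiv (ContinuousLinearMap.ext fun v => ?_)
  rw [innerSL_apply_apply, inner_averagedDisplacement L hφ,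
    ContinuousLinearMap.integral_apply (integrable_averagingWeight_smul (by fun_prop))]
  simp [inner_sub_left, inner_gradient_left]

theorem fderiv_gradient_inverse {φ : 𝔼 → ℝ} (hφ : ContDiff ℝ 2 φ)
    (hpd : ∀ x, (hessianMatrix φ x).PosDef) {S : 𝔼 → 𝔼}
    (hS : ContDiff ℝ 1 S) (hTS : ∀ y, gradient φ (S y) = y) (y : 𝔼) :
    fderiv ℝ S y = toEuclideanCLM (𝕜 := ℝ) (hessianMatrix φ (S y))⁻¹ := by
  have h1 := ((contDiff_gradient hφ).differentiable one_ne_zero (S y)).hasFDerivAt.comp y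
    (hS.differentiable one_ne_zero y).hasFDerivAt
  have h2 : (gradient φ ∘ S) = id := funext hTS
  rw [h2] at h1
  have h3 := h1.unique (hasFDerivAt_id y)
  rw [← toEuclideanCLM_hessianMatrix hφ] at h3
  have h4 : toEuclideanCLM (𝕜 := ℝ) (hessianMatrix φ (S y)) * fderiv ℝ S y = 1 := h3
  have h5 : toEuclideanCLM (𝕜 := ℝ) (hessianMatrix φ (S y))⁻¹ *
      toEuclideanCLM (𝕜 := ℝ) (hessianMatrix φ (S y)) = 1 := by
    rw [← map_mul, nonsing_inv_mul _ (hpd _).det_pos.ne'.isUnit, map_one]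
  rw [← one_mul (fderiv ℝ S y), ← h5, mul_assoc, h4, mul_one]

theorem sum_fderiv_gradient_comp {φ : 𝔼 → ℝ} (hφ : ContDiff ℝ 2 φ)
    (M : Matrix (Fin d) (Fin d) ℝ) (x : 𝔼) :
    ∑ i, fderiv ℝ (gradient φ) x (toEuclideanCLM (𝕜 := ℝ) M (EuclideanSpace.single i 1)) i =
      (M * hessianMatrix φ x).trace := by
  rw [trace_mul_comm, ← toEuclideanCLM_hessianMatrix hφ, trace]
  refine Finset.sum_congr rfl fun i _ => ?_
  rw [ofLp_toEuclideanCLM, ofLp_toEuclideanCLM, PiLp.ofLp_single, mulVec_mulVec,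
    mulVec_single_one, diag_apply, col_apply]

theorem divergence_averagedDisplacement_comp (L : 𝔼 →L[ℝ] 𝔼) {φ : 𝔼 → ℝ} (hφ : ContDiff ℝ 2 φ) (r : ℝ)
    (hpd : ∀ x, (hessianMatrix φ x).PosDef) {S : 𝔼 → 𝔼}
    (hS : ContDiff ℝ 1 S) (hTS : ∀ y, gradient φ (S y) = y) (y : 𝔼) :
    divergence (averagedDisplacement L φ r ∘ S) y =
      ∫ h, averagingWeight h *
        (((hessianMatrix φ (S y))⁻¹ * hessianMatrix φ (S y + r • L h)).trace - d) := by
  have hc' := (contDiff_gradient hφ).continuous_fderiv one_ne_zero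
  have h1 := (hasFDerivAt_averagedDisplacement L hφ r (S y)).comp y
    (hS.differentiable one_ne_zero y).hasFDerivAt
  rw [divergence, h1.fderiv, fderiv_gradient_inverse hφ hpd hS hTS]
  let ℓ : (𝔼 →L[ℝ] 𝔼) →L[ℝ] ℝ := ∑ i, (EuclideanSpace.proj i : 𝔼 →L[ℝ] ℝ).comp
    (ContinuousLinearMap.apply ℝ 𝔼 (toEuclideanCLM (𝕜 := ℝ) (hessianMatrix φ (S y))⁻¹
      (EuclideanSpace.single i 1)))
  have hℓ : ∀ M : 𝔼 →L[ℝ] 𝔼, ℓ M = ∑ i, M (toEuclideanCLM (𝕜 := ℝ) (hessianMatrix φ (S y))⁻¹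
      (EuclideanSpace.single i 1)) i := fun M => by simp [ℓ]
  have h2 := ℓ.integral_comp_comm (integrable_averagingWeight_smul
    (f := fun h => fderiv ℝ (gradient φ) (S y + r • L h) - fderiv ℝ (gradient φ) (S y))
    (by fun_prop))
  refine (hℓ _).symm.trans (h2.symm.trans (integral_congr_ae (Eventually.of_forall fun h => ?_)))
  simp only [map_smul, map_sub, smul_eq_mul]
  rw [hℓ, hℓ, sum_fderiv_gradient_comp hφ, sum_fderiv_gradient_comp hφ,
    nonsing_inv_mul _ (hpd _).det_pos.ne'.isUnit, trace_one, Fintype.card_fin]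

end Displacement

section BregmanAverage

variable {d : ℕ}

local notation "𝔼" => EuclideanSpace ℝ (Fin d)

/-- The Bregman divergence `W(z) - W(y) - ⟨∇W(y), z - y⟩`. -/
noncomputable def bregman (W : 𝔼 → ℝ) (z y : 𝔼) : ℝ :=
  W z - W y - ⟪gradient W y, z - y⟫

theorem integral_bregman_le (L : 𝔼 →L[ℝ] 𝔼) {V W φ : 𝔼 → ℝ} (hV : ContDiff ℝ 2 V)
    (hW : ContDiff ℝ 2 W) (hφ : ContDiff ℝ 2 φ) (hpd : ∀ x, (hessianMatrix φ x).PosDef)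
    (hMA : ∀ x, V x = W (gradient φ x) - Real.log (hessianMatrix φ x).det) {S : 𝔼 → 𝔼}
    (hS : ContDiff ℝ 1 S) (hTS : ∀ y, gradient φ (S y) = y) {a r : ℝ}
    (ha : ∀ x, weightedLaplacian L V x ≤ a) (hr : 0 ≤ r) (y : 𝔼) :
    ∫ h, averagingWeight h * bregman W (gradient φ (S y + r • L h)) y ≤
      r ^ 2 / 2 * (a * ∫ h : 𝔼, averagingPotential h)
        + divergence (averagedDisplacement L φ r ∘ S) y
        - ⟪averagedDisplacement L φ r (S y), gradient W y⟫ := by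
  have hT := (contDiff_gradient hφ).continuous
  have hH := continuous_hessianMatrix hφ
  have hWc := hW.continuous
  have hVc := hV.continuous
  have h1 := ellipsoidAverage_sub_le_of_laplacian_le L hV hr ha (S y)
  rw [ellipsoidAverage_sub_eq L hVc] at h1
  rw [divergence_averagedDisplacement_comp L hφ r hpd hS hTS,
    inner_averagedDisplacement L hφ]
  have hHc : Continuous fun h => hessianMatrix φ (S y + r • L h) := by fun_prop
  have i1 : Integrable fun h => averagingWeight h * (V (S y + r • L h) - V (S y)) :=
    integrable_averagingWeight_mul (by fun_prop)
  have i2 : Integrable fun h => averagingWeight h *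
      (((hessianMatrix φ (S y))⁻¹ * hessianMatrix φ (S y + r • L h)).trace - d) :=
    integrable_averagingWeight_mul
      (((continuous_const.matrix_mul hHc).matrix_trace).sub continuous_const)
  have i3 : Integrable fun h => averagingWeight h *
      ⟪gradient φ (S y + r • L h) - gradient φ (S y), gradient W y⟫ :=
    integrable_averagingWeight_mul (by fun_prop)
  refine le_trans ?_ (sub_le_sub_right (add_le_add_left h1 _) _)
  rw [← integral_add i1 i2, ← integral_sub (i1.fun_add i2) i3]
  refine integral_mono (integrable_averagingWeight_mul (by unfold bregman; fun_prop))
    ((i1.fun_add i2).sub i3) fun h => ?_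
  beta_reduce
  rw [← mul_add, ← mul_sub]
  refine mul_le_mul_of_nonneg_left ?_ (averagingWeight_nonneg h)
  have h2 := (hpd (S y)).log_det_sub_le (hpd (S y + r • L h))
  rw [Fintype.card_fin] at h2
  rw [hMA, hMA (S y), hTS, bregman, real_inner_comm]
  linarith

theorem le_integral_bregman (L : 𝔼 →L[ℝ] 𝔼) {W Wstar φ : 𝔼 → ℝ}
    (hleg : ∀ y : 𝔼, IsLUB {z : ℝ | ∃ x : 𝔼, z = ⟪x, y⟫ - W x} (Wstar y))
    (hconv : ConvexOn ℝ Set.univ W) (hW : ContDiff ℝ 2 W) (hWs : ContDiff ℝ 2 Wstar)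
    (hφ : ContDiff ℝ 2 φ) {b t r : ℝ} (hb : ∀ x, weightedLaplacian L Wstar x ≤ b)
    (ht : 0 ≤ t) (hr : 0 ≤ r) (x y : 𝔼) :
    t * r ^ 2 * (∫ h : 𝔼, averagingPotential h * weightedLaplacian L φ (x + r • L h))
        - (t * r) ^ 2 / 2 * (b * ∫ h : 𝔼, averagingPotential h) ≤
      ∫ h, averagingWeight h * bregman W (gradient φ (x + r • L h)) y := by
  have hT := (contDiff_gradient hφ).continuous
  have hWc := hW.continuous
  have hWsc := hWs.continuous
  have hφ' := hφ.continuous_fderiv two_ne_zero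
  have h1 := ellipsoidAverage_sub_le_of_laplacian_le L hWs (mul_nonneg ht hr) hb (gradient W y)
  rw [ellipsoidAverage_sub_eq L hWsc] at h1
  have h2 := integral_averagingWeight_mul_fderiv L hφ x r
  have i1 : Integrable fun h => averagingWeight h * fderiv ℝ φ (x + r • L h) (L h) :=
    integrable_averagingWeight_mul (by fun_prop)
  have i2 : Integrable fun h => averagingWeight h *
      (Wstar (gradient W y + (t * r) • L h) - Wstar (gradient W y)) :=
    integrable_averagingWeight_mul (by fun_prop)
  have h3 : t * r ^ 2 * (∫ h : 𝔼, averagingPotential h * weightedLaplacian L φ (x + r • L h)) =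
      ∫ h, t * r * (averagingWeight h * fderiv ℝ φ (x + r • L h) (L h)) := by
    rw [integral_const_mul, h2]; ring
  rw [h3]
  refine (sub_le_sub_left h1 _).trans ?_
  rw [← integral_sub (i1.const_mul _) i2]
  refine integral_mono ((i1.const_mul _).sub i2)
    (integrable_averagingWeight_mul (by unfold bregman; fun_prop)) fun h => ?_
  have h4 := mul_le_mul_of_nonneg_left (inner_sub_legendre_le_bregman hleg hconv
    (hW.differentiable two_ne_zero) y (gradient φ (x + r • L h)) ((t * r) • L h))
    (averagingWeight_nonneg h)
  rw [real_inner_smul_right, inner_gradient_left] at h4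
  simp only [bregman]
  linarith

theorem bregman_young_le {ζ τ K B : ℝ} {g z : 𝔼} (hτ : 0 < τ) (hK : 0 < K)
    (hB : ‖g‖ ^ 2 / (2 * K) ≤ B) :
    (1 - τ) * ζ ^ 2 * B - 2 * K / τ * ‖z‖ ^ 2 ≤ ζ ^ 2 * B + 2 * ζ * ⟪g, z⟫ := by
  have h1 : 0 ≤ τ / (2 * K) * ‖ζ • g + (2 * K / τ) • z‖ ^ 2 := by positivity
  rw [norm_add_sq_real, real_inner_smul_left, real_inner_smul_right, norm_smul, norm_smul, mul_pow,
    mul_pow, Real.norm_eq_abs, Real.norm_eq_abs, sq_abs, sq_abs] at h1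
  have h2 : τ / (2 * K) * (ζ ^ 2 * ‖g‖ ^ 2 + 2 * (ζ * (2 * K / τ * ⟪g, z⟫))
      + (2 * K / τ) ^ 2 * ‖z‖ ^ 2) =
      τ * ζ ^ 2 * (‖g‖ ^ 2 / (2 * K)) + 2 * ζ * ⟪g, z⟫ + 2 * K / τ * ‖z‖ ^ 2 := by
    field_simp
  rw [h2] at h1
  have h3 := mul_le_mul_of_nonneg_left hB (by positivity : 0 ≤ τ * ζ ^ 2)
  linarith

theorem le_integral_bregman_add_inner (L : 𝔼 →L[ℝ] 𝔼) {W Wstar φ : 𝔼 → ℝ}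
    (hleg : ∀ y : 𝔼, IsLUB {z : ℝ | ∃ x : 𝔼, z = ⟪x, y⟫ - W x} (Wstar y))
    (hconv : ConvexOn ℝ Set.univ W) (hW : ContDiff ℝ 2 W) (hWs : ContDiff ℝ 2 Wstar)
    (hφ : ContDiff ℝ 2 φ) {K : ℝ} (hK0 : 0 < K)
    (hK : ∀ x u, fderiv ℝ (fderiv ℝ Wstar) x u u ≤ K * ‖u‖ ^ 2)
    {τ : ℝ} (hτ : 0 < τ) (ζ r : ℝ) (x z : 𝔼) :
    (1 - τ) * ζ ^ 2 *
        (∫ h, averagingWeight h * bregman W (gradient φ (x + r • L h)) (gradient φ x))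
        - 2 * K / τ * ‖z‖ ^ 2 * (∫ h : 𝔼, averagingWeight h) ≤
      ζ ^ 2 * (∫ h, averagingWeight h * bregman W (gradient φ (x + r • L h)) (gradient φ x))
        + 2 * ζ * ⟪averagedDisplacement L φ r x, z⟫ := by
  have hT := (contDiff_gradient hφ).continuous
  have hWc := hW.continuous
  rw [inner_averagedDisplacement L hφ]
  have i1 : Integrable fun h => averagingWeight h *
      bregman W (gradient φ (x + r • L h)) (gradient φ x) :=
    integrable_averagingWeight_mul (by unfold bregman; fun_prop)
  have i2 : Integrable (averagingWeight : 𝔼 → ℝ) := by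
    simpa using integrable_averagingWeight_mul (f := fun _ : 𝔼 => 1) continuous_const
  have i3 : Integrable fun h => averagingWeight h *
      ⟪gradient φ (x + r • L h) - gradient φ x, z⟫ :=
    integrable_averagingWeight_mul (by fun_prop)
  rw [← integral_const_mul, ← integral_const_mul, ← integral_const_mul, ← integral_const_mul,
    ← integral_sub (i1.const_mul _) (i2.const_mul _),
    ← integral_add (i1.const_mul _) (i3.const_mul _)]
  refine integral_mono ((i1.const_mul _).sub (i2.const_mul _))
    ((i1.const_mul _).add (i3.const_mul _)) fun h => ?_
  have h1 := mul_le_mul_of_nonneg_left (bregman_young_le (ζ := ζ) (z := z) hτ hK0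
    (sq_norm_sub_le_bregman hleg hconv (hW.differentiable two_ne_zero) hWs hK0 hK
      (gradient φ x) (gradient φ (x + r • L h)))) (averagingWeight_nonneg h)
  simp only [bregman]
  linarith

end BregmanAverage

section Cutoff

variable {d : ℕ}

local notation "𝔼" => EuclideanSpace ℝ (Fin d)

theorem inner_fderiv_gradient_inverse_nonneg {φ : 𝔼 → ℝ} (hφ : ContDiff ℝ 2 φ)
    (hpd : ∀ x, (hessianMatrix φ x).PosDef) {S : 𝔼 → 𝔼}
    (hS : ContDiff ℝ 1 S) (hTS : ∀ y, gradient φ (S y) = y) (y v : 𝔼) :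
    0 ≤ ⟪v, fderiv ℝ S y v⟫ := by
  rw [fderiv_gradient_inverse hφ hpd hS hTS, EuclideanSpace.inner_eq_star_dotProduct,
    ofLp_toEuclideanCLM, dotProduct_comm]
  exact (hpd (S y)).inv.posSemidef.dotProduct_mulVec_nonneg v.ofLp

theorem continuous_integral_averagingPotential (L : 𝔼 →L[ℝ] 𝔼) {φ : 𝔼 → ℝ}
    (hφ : ContDiff ℝ 2 φ) (r : ℝ) :
    Continuous fun x : 𝔼 =>
      ∫ h : 𝔼, averagingPotential h * weightedLaplacian L φ (x + r • L h) := by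
  have := continuous_weightedLaplacian L hφ
  exact continuous_integral_weight (volume : Measure 𝔼) continuous_averagingPotential
    hasCompactSupport_averagingPotential
    (F := fun x h => weightedLaplacian L φ (x + r • L h)) (by fun_prop)

/-- The excess, over the bounds `a` for `V` and `b` for the Legendre transform of `W`, of the
averaged weighted Laplacian of `φ`. -/
noncomputable def laplacianExcess (L : 𝔼 →L[ℝ] 𝔼) (φ : 𝔼 → ℝ) (a b t τ r : ℝ) (x : 𝔼) : ℝ :=
  (1 - τ) * (t * r ^ 2 * (∫ h : 𝔼, averagingPotential h * weightedLaplacian L φ (x + r • L h))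
    - (t * r) ^ 2 / 2 * (b * ∫ h : 𝔼, averagingPotential h))
    - r ^ 2 / 2 * (a * ∫ h : 𝔼, averagingPotential h)

theorem le_divergence_cutoff (L : 𝔼 →L[ℝ] 𝔼) {V W Wstar φ : 𝔼 → ℝ} (hV : ContDiff ℝ 2 V)
    (hleg : ∀ y : 𝔼, IsLUB {z : ℝ | ∃ x : 𝔼, z = ⟪x, y⟫ - W x} (Wstar y))
    (hconv : ConvexOn ℝ Set.univ W) (hW : ContDiff ℝ 2 W) (hWs : ContDiff ℝ 2 Wstar)
    (hφ : ContDiff ℝ 2 φ) (hpd : ∀ x, (hessianMatrix φ x).PosDef)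
    (hMA : ∀ x, V x = W (gradient φ x) - Real.log (hessianMatrix φ x).det) {S : 𝔼 → 𝔼}
    (hS : ContDiff ℝ 1 S) (hTS : ∀ y, gradient φ (S y) = y)
    {a b K t r τ : ℝ} (ha : ∀ x, weightedLaplacian L V x ≤ a)
    (hb : ∀ x, weightedLaplacian L Wstar x ≤ b) (hK0 : 0 < K)
    (hK : ∀ x u, fderiv ℝ (fderiv ℝ Wstar) x u u ≤ K * ‖u‖ ^ 2)
    (ht : 0 ≤ t) (hr : 0 ≤ r) (hτ : 0 < τ) (hτ1 : τ ≤ 1)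
    {p : ℝ → ℝ} (hp : Differentiable ℝ p) (hp0 : ∀ s, 0 ≤ p s) (hp' : ∀ s, 0 ≤ deriv p s)
    {ζ : 𝔼 → ℝ} (hζ : Differentiable ℝ ζ) (y : 𝔼) :
    Real.exp (-W y) * (p (ellipsoidAverage L φ r (S y) - ellipsoidAverage L φ 0 (S y)) * (ζ y ^ 2 *
        laplacianExcess L φ a b t τ r (S y))) -
      Real.exp (-W y) * (p (ellipsoidAverage L φ r (S y) - ellipsoidAverage L φ 0 (S y)) *
        (2 * K / τ * ‖gradient ζ y‖ ^ 2 * ∫ h : 𝔼, averagingWeight h)) ≤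
      divergence (fun z => (ζ z ^ 2 *
        p (ellipsoidAverage L φ r (S z) - ellipsoidAverage L φ 0 (S z)) * Real.exp (-W z)) •
          (averagedDisplacement L φ r ∘ S) z) y := by
  unfold laplacianExcess
  set u : 𝔼 → ℝ := fun z => ellipsoidAverage L φ r z - ellipsoidAverage L φ 0 z with hu
  change Real.exp (-W y) * (p (u (S y)) * _) - Real.exp (-W y) * (p (u (S y)) * _) ≤
    divergence (fun z => (ζ z ^ 2 * p (u (S z)) * Real.exp (-W z)) •
          (averagedDisplacement L φ r ∘ S) z) y
  have hSd := (hS.differentiable one_ne_zero y).hasFDerivAt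
  have h1 : HasFDerivAt (fun z => p (u (S z))) _ y :=
    (hp (u (S y))).hasDerivAt.comp_hasFDerivAt y
      ((hasFDerivAt_ellipsoidAverage_sub L hφ r (S y)).comp y hSd)
  have h2 := (hζ y).hasFDerivAt.pow 2
  have h3 := (hW.differentiable two_ne_zero y).hasFDerivAt.neg.exp
  have h4 : HasFDerivAt (fun z => ζ z ^ 2 * p (u (S z)) * Real.exp (-W z)) _ y :=
    (h2.mul h1).mul h3
  have hG := ((contDiff_averagedDisplacement L hφ r).comp hS).differentiable one_ne_zero y
  rw [divergence_smul h4.differentiableAt hG, h4.fderiv]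
  have hA := integral_bregman_le L hV hW hφ hpd hMA hS hTS ha hr y
  have hB1 := le_integral_bregman L hleg hconv hW hWs hφ hb ht hr (S y) y
  have hB2 := le_integral_bregman_add_inner L hleg hconv hW hWs hφ hK0 hK hτ (ζ y) r (S y)
    (gradient ζ y)
  rw [hTS] at hB2
  have hC := inner_fderiv_gradient_inverse_nonneg hφ hpd hS hTS y (averagedDisplacement L φ r (S y))
  have hζG : fderiv ℝ ζ y (averagedDisplacement L φ r (S y)) =
      ⟪averagedDisplacement L φ r (S y), gradient ζ y⟫ := by
    rw [real_inner_comm, inner_gradient_left]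
  have hWG : fderiv ℝ W y (averagedDisplacement L φ r (S y)) =
      ⟪averagedDisplacement L φ r (S y), gradient W y⟫ := by
    rw [real_inner_comm, inner_gradient_left]
  simp only [_root_.add_apply, _root_.smul_apply, _root_.neg_apply, smul_eq_mul, hζG, hWG,
    Function.comp_apply, ContinuousLinearMap.comp_apply, innerSL_apply_apply, Pi.mul_apply]
  generalize ∫ h, averagingWeight h * bregman W (gradient φ (S y + r • L h)) y = I at *
  generalize ∫ h : 𝔼, averagingPotential h * weightedLaplacian L φ (S y + r • L h) = N at *
  generalize divergence (averagedDisplacement L φ r ∘ S) y = D at *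
  generalize ⟪averagedDisplacement L φ r (S y), gradient ζ y⟫ = q1 at *
  generalize ⟪averagedDisplacement L φ r (S y), gradient W y⟫ = q2 at *
  generalize ⟪averagedDisplacement L φ r (S y), fderiv ℝ S y (averagedDisplacement L φ r (S y))⟫
    = q3 at *
  have e1 := mul_le_mul_of_nonneg_left hA (sq_nonneg (ζ y))
  have e2 := mul_le_mul_of_nonneg_left hB1 (mul_nonneg (sub_nonneg.2 hτ1) (sq_nonneg (ζ y)))
  have e3 := mul_nonneg (mul_nonneg (sq_nonneg (ζ y)) (hp' (u (S y)))) hC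
  have hE := (Real.exp_pos (-W y)).le
  generalize Real.exp (-W y) = E at *
  have e4 := hp0 (u (S y))
  generalize p (u (S y)) = P at *
  generalize deriv p (u (S y)) = P' at *
  generalize ∫ h : 𝔼, averagingPotential h = c at *
  generalize ∫ h : 𝔼, averagingWeight h = m at *
  have e5 : ζ y ^ 2 * ((1 - τ) * (t * r ^ 2 * N - (t * r) ^ 2 / 2 * (b * c))
      - r ^ 2 / 2 * (a * c)) - 2 * K / τ * ‖gradient ζ y‖ ^ 2 * m ≤
      ζ y ^ 2 * (D - q2) + 2 * ζ y * q1 := by linarith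
  have e6 := mul_le_mul_of_nonneg_left (mul_le_mul_of_nonneg_left e5 e4) hE
  have e7 := mul_nonneg hE e3
  norm_num
  linarith

theorem integral_cutoff_le (L : 𝔼 →L[ℝ] 𝔼) {V W Wstar φ : 𝔼 → ℝ} (hV : ContDiff ℝ 2 V)
    (hleg : ∀ y : 𝔼, IsLUB {z : ℝ | ∃ x : 𝔼, z = ⟪x, y⟫ - W x} (Wstar y))
    (hconv : ConvexOn ℝ Set.univ W) (hW : ContDiff ℝ 2 W) (hWs : ContDiff ℝ 2 Wstar)
    (hWint : Integrable fun y => Real.exp (-W y)) (hWone : ∫ y, Real.exp (-W y) = 1)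
    (hφ : ContDiff ℝ 2 φ) (hpd : ∀ x, (hessianMatrix φ x).PosDef)
    (hMA : ∀ x, V x = W (gradient φ x) - Real.log (hessianMatrix φ x).det) {S : 𝔼 → 𝔼}
    (hS : ContDiff ℝ 1 S) (hTS : ∀ y, gradient φ (S y) = y)
    {a b K t r τ : ℝ} (ha : ∀ x, weightedLaplacian L V x ≤ a)
    (hb : ∀ x, weightedLaplacian L Wstar x ≤ b) (hK0 : 0 < K)
    (hK : ∀ x u, fderiv ℝ (fderiv ℝ Wstar) x u u ≤ K * ‖u‖ ^ 2)
    (ht : 0 ≤ t) (hr : 0 ≤ r) (hτ : 0 < τ) (hτ1 : τ ≤ 1)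
    {p : ℝ → ℝ} (hp : ContDiff ℝ 1 p) (hp0 : ∀ s, 0 ≤ p s) (hp1 : ∀ s, p s ≤ 1)
    (hp' : ∀ s, 0 ≤ deriv p s)
    {ζ : 𝔼 → ℝ} (hζ : ContDiff ℝ 1 ζ) (hζc : HasCompactSupport ζ) {B : ℝ}
    (hB : ∀ y, ‖gradient ζ y‖ ≤ B) :
    Integrable (fun y => Real.exp (-W y) *
      (p (ellipsoidAverage L φ r (S y) - ellipsoidAverage L φ 0 (S y)) * (ζ y ^ 2 *
        laplacianExcess L φ a b t τ r (S y)))) ∧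
    ∫ y, Real.exp (-W y) *
      (p (ellipsoidAverage L φ r (S y) - ellipsoidAverage L φ 0 (S y)) * (ζ y ^ 2 *
        laplacianExcess L φ a b t τ r (S y))) ≤
      2 * K / τ * B ^ 2 * ∫ h : 𝔼, averagingWeight h := by
  have hu : ContDiff ℝ 1 fun z => ellipsoidAverage L φ r z - ellipsoidAverage L φ 0 z := by
    refine contDiff_one_iff_hasFDerivAt.2 ⟨_, ?_, hasFDerivAt_ellipsoidAverage_sub L hφ r⟩
    exact (innerSL ℝ).continuous.comp (contDiff_averagedDisplacement L hφ r).continuous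
  have hpu : ContDiff ℝ 1 fun y =>
      p (ellipsoidAverage L φ r (S y) - ellipsoidAverage L φ 0 (S y)) := hp.comp (hu.comp hS)
  have hpuc := hpu.continuous
  have hW1 : ContDiff ℝ 1 W := hW.of_le one_le_two
  have hY : ContDiff ℝ 1 fun z => (ζ z ^ 2 *
        p (ellipsoidAverage L φ r (S z) - ellipsoidAverage L φ 0 (S z)) * Real.exp (-W z)) •
          (averagedDisplacement L φ r ∘ S) z :=
    ((((hζ.pow 2).mul hpu).mul hW1.neg.exp).smul ((contDiff_averagedDisplacement L hφ r).comp hS))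
  have hYc : HasCompactSupport fun z => (ζ z ^ 2 *
        p (ellipsoidAverage L φ r (S z) - ellipsoidAverage L φ 0 (S z)) * Real.exp (-W z)) •
          (averagedDisplacement L φ r ∘ S) z :=
    hζc.mono fun z hz h0 => hz (by simp [h0])
  have hdiv := integral_divergence_eq_zero hY hYc
  have hN := (continuous_integral_averagingPotential L hφ r).comp hS.continuous
  have hζ0 := hζ.continuous
  have hW0 := hW.continuous
  have hgrad : Continuous (gradient ζ) := by
    unfold gradient
    exact (InnerProductSpace.toDual ℝ 𝔼).symm.continuous.comp (hζ.continuous_fderiv one_ne_zero)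
  have i1 : Integrable fun y => Real.exp (-W y) *
      (p (ellipsoidAverage L φ r (S y) - ellipsoidAverage L φ 0 (S y)) * (ζ y ^ 2 *
        laplacianExcess L φ a b t τ r (S y))) := by
    simp only [Function.comp_def] at hN
    unfold laplacianExcess
    exact Continuous.integrable_of_hasCompactSupport
      (hW0.neg.rexp.mul (hpuc.mul (by fun_prop)))
      (hζc.mono fun z hz h0 => hz (by simp [h0]))
  have i2 : Integrable fun y => Real.exp (-W y) *
      (p (ellipsoidAverage L φ r (S y) - ellipsoidAverage L φ 0 (S y)) *
        (2 * K / τ * ‖gradient ζ y‖ ^ 2 * ∫ h : 𝔼, averagingWeight h)) :=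
    Continuous.integrable_of_hasCompactSupport (hW0.neg.rexp.mul (hpuc.mul (by fun_prop)))
      ((hζc.fderiv ℝ).mono fun z hz h0 => hz (by simp [gradient, h0]))
  have h1 : ∫ y, (Real.exp (-W y) *
      (p (ellipsoidAverage L φ r (S y) - ellipsoidAverage L φ 0 (S y)) * (ζ y ^ 2 *
        laplacianExcess L φ a b t τ r (S y))) - Real.exp (-W y) *
      (p (ellipsoidAverage L φ r (S y) - ellipsoidAverage L φ 0 (S y)) *
        (2 * K / τ * ‖gradient ζ y‖ ^ 2 * ∫ h : 𝔼, averagingWeight h))) ≤ 0 := by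
    refine le_trans ?_ hdiv.le
    exact integral_mono (i1.sub i2) ((continuous_divergence hY).integrable_of_hasCompactSupport
      (hasCompactSupport_divergence hYc)) fun y => le_divergence_cutoff L hV hleg hconv hW hWs hφ
        hpd hMA hS hTS ha hb hK0 hK ht hr hτ hτ1 (hp.differentiable one_ne_zero) hp0 hp'
        (hζ.differentiable one_ne_zero) y
  rw [integral_sub i1 i2] at h1
  refine ⟨i1, ?_⟩
  have hm : 0 ≤ ∫ h : 𝔼, averagingWeight h := integral_nonneg averagingWeight_nonneg
  have h2 : ∫ y, Real.exp (-W y) *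
      (p (ellipsoidAverage L φ r (S y) - ellipsoidAverage L φ 0 (S y)) *
        (2 * K / τ * ‖gradient ζ y‖ ^ 2 * ∫ h : 𝔼, averagingWeight h)) ≤
      ∫ y, Real.exp (-W y) * (2 * K / τ * B ^ 2 * ∫ h : 𝔼, averagingWeight h) := by
    refine integral_mono i2 (hWint.mul_const _) fun y => ?_
    refine mul_le_mul_of_nonneg_left ?_ (Real.exp_pos _).le
    refine (mul_le_of_le_one_left (by positivity) (hp1 _)).trans ?_
    have := hB y
    gcongr
  rw [integral_mul_const, hWone, one_mul] at h2
  linarith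

end Cutoff

section Limit

variable {d : ℕ}

local notation "𝔼" => EuclideanSpace ℝ (Fin d)

theorem exists_cutoff : ∃ C : ℝ, ∀ R : ℝ, 0 < R → ∃ ζ : 𝔼 → ℝ, ContDiff ℝ 1 ζ ∧
    HasCompactSupport ζ ∧ (∀ y, 0 ≤ ζ y) ∧ (∀ y, ζ y ≤ 1) ∧ (∀ y, ‖y‖ ≤ R → ζ y = 1) ∧
    ∀ y, ‖gradient ζ y‖ ≤ C / R := by
  let f : ContDiffBump (0 : 𝔼) := ⟨1, 2, one_pos, one_lt_two⟩
  have hf : ContDiff ℝ 1 f := f.contDiff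
  obtain ⟨C, hC⟩ := (f.hasCompactSupport.fderiv ℝ).exists_bound_of_continuous
    (hf.continuous_fderiv one_ne_zero)
  refine ⟨C, fun R hR => ⟨fun y => f (R⁻¹ • y), by fun_prop,
    f.hasCompactSupport.comp_homeomorph (Homeomorph.smulOfNeZero R⁻¹ (inv_pos.2 hR).ne'),
    fun y => f.nonneg, fun y => f.le_one, fun y hy => ?_, fun y => ?_⟩⟩
  · refine f.one_of_mem_closedBall (mem_closedBall_zero_iff.2 ?_)
    change ‖R⁻¹ • y‖ ≤ 1
    rw [norm_smul, norm_inv, Real.norm_eq_abs, abs_of_pos hR, inv_mul_le_iff₀ hR]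
    linarith
  · rw [gradient, LinearIsometryEquiv.norm_map, fderiv_comp_smul, norm_smul, norm_inv,
      Real.norm_eq_abs, abs_of_pos hR, div_eq_inv_mul]
    exact mul_le_mul_of_nonneg_left (hC _) (inv_pos.2 hR).le

theorem eq_zero_of_tendsto_of_integral_le {E F : 𝔼 → ℝ} {Fn : ℕ → 𝔼 → ℝ} {M : ℝ} {ε : ℕ → ℝ}
    (hE : Continuous E) (hE0 : ∀ y, 0 < E y) (hEi : Integrable E)
    (hF : Continuous F) (hF0 : ∀ y, 0 ≤ F y)
    (hFi : ∀ n, Integrable fun y => E y * Fn n y) (hM : ∀ n y, -M ≤ Fn n y)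
    (hlim : ∀ y, Tendsto (fun n => Fn n y) atTop (𝓝 (F y)))
    (hle : ∀ n, ∫ y, E y * Fn n y ≤ ε n) (hε : Tendsto ε atTop (𝓝 0)) (y : 𝔼) : F y = 0 := by
  have hi : ∀ n, Integrable fun y => min (E y * Fn n y) (E y) := fun n => (hFi n).inf hEi
  have h1 : Tendsto (fun n => ∫ y, min (E y * Fn n y) (E y)) atTop
      (𝓝 (∫ y, min (E y * F y) (E y))) := by
    refine tendsto_integral_of_dominated_convergence (fun y => (|M| + 1) * E y)
      (fun n => (hi n).aestronglyMeasurable) (hEi.const_mul _)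
      (fun n => Eventually.of_forall fun y => ?_)
      (Eventually.of_forall fun y => ((hlim y).const_mul _).min tendsto_const_nhds)
    have h2 := mul_le_mul_of_nonneg_left (hM n y) (hE0 y).le
    have h3 := mul_le_mul_of_nonneg_left (le_abs_self M) (hE0 y).le
    have h4 := mul_nonneg (abs_nonneg M) (hE0 y).le
    have h5 := (hE0 y).le
    rw [Real.norm_eq_abs, abs_le]
    refine ⟨le_min ?_ ?_, (min_le_right _ _).trans ?_⟩ <;> linarith
  have h2 : ∫ y, min (E y * F y) (E y) ≤ 0 :=
    le_of_tendsto_of_tendsto' h1 hε fun n =>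
      (integral_mono (hi n) (hFi n) fun y => min_le_left _ _).trans (hle n)
  have h3 : ∀ y, 0 ≤ min (E y * F y) (E y) := fun y =>
    le_min (mul_nonneg (hE0 y).le (hF0 y)) (hE0 y).le
  have hc : Continuous fun y => min (E y * F y) (E y) := (hE.mul hF).min hE
  have hgi : Integrable fun y => min (E y * F y) (E y) :=
    hEi.mono' hc.aestronglyMeasurable (Eventually.of_forall fun y => by
      rw [Real.norm_eq_abs, abs_of_nonneg (h3 y)]; exact min_le_right _ _)
  have h4 := (integral_eq_zero_iff_of_nonneg h3 hgi).1
    (le_antisymm h2 (integral_nonneg h3))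
  have h5 := congrFun ((hc.ae_eq_iff_eq volume continuous_zero).1 h4) y
  simp only [Pi.zero_apply] at h5
  rcases min_choice (E y * F y) (E y) with h | h <;> rw [h] at h5
  · exact (mul_eq_zero.1 h5).resolve_left (hE0 y).ne'
  · exact absurd h5 (hE0 y).ne'

theorem integral_averagingPotential_pos : 0 < ∫ h : 𝔼, averagingPotential h :=
  continuous_averagingPotential.integral_pos_of_hasCompactSupport_nonneg_nonzero
    hasCompactSupport_averagingPotential averagingPotential_nonneg
    (x := 0) (by simp [averagingPotential])

theorem weightedLaplacian_nonneg (L : 𝔼 →L[ℝ] 𝔼) {φ : 𝔼 → ℝ} (hφ : ContDiff ℝ 2 φ)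
    (hconv : ConvexOn ℝ Set.univ φ) (x : 𝔼) : 0 ≤ weightedLaplacian L φ x :=
  Finset.sum_nonneg fun _ _ => hconv.fderiv_fderiv_nonneg hφ _ _

theorem laplacianExcess_div_sq (L : 𝔼 →L[ℝ] 𝔼) (φ : 𝔼 → ℝ) (a b t τ : ℝ) {r : ℝ} (hr : r ≠ 0)
    (x : 𝔼) : laplacianExcess L φ a b t τ r x / r ^ 2 =
      (1 - τ) * (t * (∫ h : 𝔼, averagingPotential h * weightedLaplacian L φ (x + r • L h))
        - t ^ 2 / 2 * (b * ∫ h : 𝔼, averagingPotential h))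
        - (a * ∫ h : 𝔼, averagingPotential h) / 2 := by
  unfold laplacianExcess
  field_simp

theorem weightedLaplacian_le_of_mul_lt (L : 𝔼 →L[ℝ] 𝔼) {V W Wstar φ : 𝔼 → ℝ}
    (hV : ContDiff ℝ 2 V)
    (hleg : ∀ y : 𝔼, IsLUB {z : ℝ | ∃ x : 𝔼, z = ⟪x, y⟫ - W x} (Wstar y))
    (hconv : ConvexOn ℝ Set.univ W) (hW : ContDiff ℝ 2 W) (hWs : ContDiff ℝ 2 Wstar)
    (hWint : Integrable fun y => Real.exp (-W y)) (hWone : ∫ y, Real.exp (-W y) = 1)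
    (hφ : ContDiff ℝ 2 φ) (hφconv : ConvexOn ℝ Set.univ φ)
    (hpd : ∀ x, (hessianMatrix φ x).PosDef)
    (hMA : ∀ x, V x = W (gradient φ x) - Real.log (hessianMatrix φ x).det) {S : 𝔼 → 𝔼}
    (hS : ContDiff ℝ 1 S) (hTS : ∀ y, gradient φ (S y) = y)
    {a b K : ℝ} (ha0 : 0 ≤ a) (hb0 : 0 < b) (ha : ∀ x, weightedLaplacian L V x ≤ a)
    (hb : ∀ x, weightedLaplacian L Wstar x ≤ b) (hK0 : 0 < K)
    (hK : ∀ x u, fderiv ℝ (fderiv ℝ Wstar) x u u ≤ K * ‖u‖ ^ 2)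
    {κ : ℝ} (hκ0 : 0 < κ) (hκ : a * b < κ ^ 2) (y : 𝔼) : weightedLaplacian L φ (S y) ≤ κ := by
  by_contra! hcon
  obtain ⟨C, hC⟩ := exists_cutoff (d := d)
  have hc0 : 0 < ∫ h : 𝔼, averagingPotential h := integral_averagingPotential_pos
  set c : ℝ := ∫ h : 𝔼, averagingPotential h with hc
  set t : ℝ := κ / b with ht
  set τ : ℝ := (κ ^ 2 - a * b) / (2 * κ ^ 2) with hτ
  have ht0 : 0 < t := div_pos hκ0 hb0
  have hτ0 : 0 < τ := div_pos (by linarith) (by positivity)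
  have hab : 0 ≤ a * b := mul_nonneg ha0 hb0.le
  have hτ1 : τ < 1 := by rw [hτ, div_lt_one (by positivity)]; nlinarith
  have hgap : 0 < (1 - τ) * (t * (κ * c) - t ^ 2 / 2 * (b * c)) - a * c / 2 := by
    have : (1 - τ) * (t * (κ * c) - t ^ 2 / 2 * (b * c)) - a * c / 2 =
        c * (κ ^ 2 - a * b) / (4 * b) := by
      rw [ht, hτ]; field_simp; ring
    rw [this]
    exact div_pos (mul_pos hc0 (by linarith)) (by positivity)
  have hgap' : ∀ α, κ ≤ α →
      0 < (1 - τ) * (t * (α * c) - t ^ 2 / 2 * (b * c)) - a * c / 2 := fun α hα => by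
    refine hgap.trans_le ?_
    have : 0 ≤ 1 - τ := by linarith
    gcongr
  let r : ℕ → ℝ := fun n => ((n : ℝ) + 1)⁻¹
  have hr : ∀ n, 0 < r n := fun n => by positivity
  have hr0 : Tendsto r atTop (𝓝 0) := by
    simpa [r, one_div] using tendsto_one_div_add_atTop_nhds_zero_nat (𝕜 := ℝ)
  have hrw : Tendsto r atTop (𝓝[>] 0) :=
    tendsto_nhdsWithin_iff.2 ⟨hr0, Eventually.of_forall hr⟩
  choose ζ hζ hζc hζ0 hζ1 hζe hζg using fun n : ℕ => hC (((n : ℝ) + 1) ^ 2) (by positivity)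
  let p : ℕ → ℝ → ℝ := fun n s => Real.smoothTransition (s / r n ^ 2 - κ * c / 2)
  have hp : ∀ n, ContDiff ℝ 1 (p n) := fun n =>
    (Real.smoothTransition.contDiff (n := 1)).comp (by fun_prop)
  have hp' : ∀ n s, 0 ≤ deriv (p n) s := fun n s => by
    refine Monotone.deriv_nonneg fun u v huv => Real.smoothTransition.monotone ?_
    have := hr n
    gcongr
  have key := fun n => integral_cutoff_le L hV hleg hconv hW hWs hWint hWone hφ hpd hMA hS hTS ha hb
    hK0 hK ht0.le (hr n).le hτ0 hτ1.le (hp n) (fun s => Real.smoothTransition.nonneg _)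
    (fun s => Real.smoothTransition.le_one _) (hp' n) (hζ n) (hζc n) (hζg n)
  let Fn : ℕ → 𝔼 → ℝ := fun n y =>
    p n (ellipsoidAverage L φ (r n) (S y) - ellipsoidAverage L φ 0 (S y)) *
      (ζ n y ^ 2 * (laplacianExcess L φ a b t τ (r n) (S y) / r n ^ 2))
  let F : 𝔼 → ℝ := fun y =>
    Real.smoothTransition (weightedLaplacian L φ (S y) * c / 2 - κ * c / 2) *
      ((1 - τ) * (t * (weightedLaplacian L φ (S y) * c) - t ^ 2 / 2 * (b * c)) - a * c / 2)
  have hFn : ∀ n, (fun y => Real.exp (-W y) * Fn n y) = fun y => (r n ^ 2)⁻¹ * (Real.exp (-W y) *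
      (p n (ellipsoidAverage L φ (r n) (S y) - ellipsoidAverage L φ 0 (S y)) * (ζ n y ^ 2 *
        laplacianExcess L φ a b t τ (r n) (S y)))) := fun n => by
    funext y; simp only [Fn]; ring
  have hF : F y = 0 := by
    refine eq_zero_of_tendsto_of_integral_le (E := fun y => Real.exp (-W y)) (Fn := Fn)
      (M := t ^ 2 / 2 * (b * c) + a * c / 2)
      (ε := fun n => 2 * K / τ * C ^ 2 * (∫ h : 𝔼, averagingWeight h) * r n ^ 2)
      hW.continuous.neg.rexp (fun y => Real.exp_pos _) hWint ?_ ?_ ?_ ?_ ?_ ?_ ?_ y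
    · have h1 := (continuous_weightedLaplacian L hφ).comp hS.continuous
      simp only [Function.comp_def] at h1
      exact (Real.smoothTransition.continuous.comp (by fun_prop)).mul (by fun_prop)
    · intro y
      rcases le_or_gt κ (weightedLaplacian L φ (S y)) with h | h
      · exact mul_nonneg (Real.smoothTransition.nonneg _) (hgap' _ h).le
      · simp only [F]
        rw [Real.smoothTransition.zero_of_nonpos, zero_mul]
        have := mul_lt_mul_of_pos_right h hc0
        linarith
    · intro n
      rw [hFn]
      exact (key n).1.const_mul _
    · intro n y
      have hw0 : 0 ≤ p n (ellipsoidAverage L φ (r n) (S y) - ellipsoidAverage L φ 0 (S y)) :=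
        Real.smoothTransition.nonneg _
      have hw1 : p n (ellipsoidAverage L φ (r n) (S y) - ellipsoidAverage L φ 0 (S y)) ≤ 1 :=
        Real.smoothTransition.le_one _
      have hz0 := sq_nonneg (ζ n y)
      have hz1 : ζ n y ^ 2 ≤ 1 := pow_le_one₀ (hζ0 n y) (hζ1 n y)
      have hN : 0 ≤ ∫ h : 𝔼, averagingPotential h * weightedLaplacian L φ (S y + r n • L h) :=
        integral_nonneg fun h =>
          mul_nonneg (averagingPotential_nonneg h) (weightedLaplacian_nonneg L hφ hφconv _)
      have hM : 0 ≤ t ^ 2 / 2 * (b * c) + a * c / 2 := by positivity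
      have he : -(t ^ 2 / 2 * (b * c) + a * c / 2) ≤
          laplacianExcess L φ a b t τ (r n) (S y) / r n ^ 2 := by
        rw [laplacianExcess_div_sq L φ a b t τ (hr n).ne']
        have h1 : 0 ≤ 1 - τ := by linarith
        have h2 := mul_nonneg h1 (mul_nonneg ht0.le hN)
        have h3 : 0 ≤ τ * (t ^ 2 / 2 * (b * c)) := by positivity
        linarith
      have h1 := mul_le_mul_of_nonneg_left he (mul_nonneg hw0 hz0)
      have h2 := mul_le_mul_of_nonneg_right (mul_le_one₀ hw1 hz0 hz1) hM
      simp only [Fn]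
      linarith
    · intro y
      have h1 := (tendsto_ellipsoidAverage L hφ (S y)).comp hrw
      have h2 := (tendsto_integral_averagingPotential L hφ (S y)).comp hr0
      have h3 : Tendsto (fun n => ζ n y ^ 2) atTop (𝓝 1) := by
        refine tendsto_const_nhds.congr' ?_
        obtain ⟨N, hN⟩ := exists_nat_ge ‖y‖
        filter_upwards [eventually_ge_atTop N] with n hn
        have hn' : (N : ℝ) ≤ n := by exact_mod_cast hn
        rw [hζe n y (by nlinarith [norm_nonneg y]), one_pow]
      have h4 := ((Real.smoothTransition.continuous.tendsto _).comp
        (h1.sub_const (κ * c / 2))).mul (h3.mul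
          ((((h2.const_mul t).sub_const (t ^ 2 / 2 * (b * c))).const_mul (1 - τ)).sub_const
            (a * c / 2)))
      rw [one_mul] at h4
      refine h4.congr fun n => ?_
      simp only [Fn, p, Function.comp_apply]
      rw [laplacianExcess_div_sq L φ a b t τ (hr n).ne']
    · intro n
      rw [hFn, integral_const_mul]
      refine (mul_le_mul_of_nonneg_left (key n).2 (by positivity)).trans (le_of_eq ?_)
      simp only [r]
      field_simp
    · simpa using (hr0.pow 2).const_mul (2 * K / τ * C ^ 2 * (∫ h : 𝔼, averagingWeight h))
  refine absurd hF (mul_pos (Real.smoothTransition.pos_of_pos ?_) (hgap' _ hcon.le)).ne'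
  have := mul_lt_mul_of_pos_right hcon hc0
  linarith

end Limit

theorem integrable_integral_eq_one_of_isProbabilityMeasure {X : Type*} [MeasurableSpace X]
    {μ : Measure X} {g : X → ℝ} (hg : AEStronglyMeasurable g μ) (hg0 : ∀ x, 0 ≤ g x)
    (hprob : IsProbabilityMeasure (μ.withDensity fun x => ENNReal.ofReal (g x))) :
    Integrable g μ ∧ ∫ x, g x ∂μ = 1 := by
  have h1 := hprob.measure_univ
  rw [withDensity_apply _ MeasurableSet.univ, Measure.restrict_univ] at h1
  refine ⟨⟨hg, ?_⟩, ?_⟩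
  · rw [hasFiniteIntegral_iff_ofReal (Eventually.of_forall hg0), h1]
    exact ENNReal.one_lt_top
  · rw [integral_eq_lintegral_of_nonneg_ae (Eventually.of_forall hg0) hg, h1, ENNReal.toReal_one]

/-- Theorem A: for a good function `f` on symmetric matrices, bounds
`f(∇²V) ≤ Λ_V` and `f(∇²W*) ≤ 1/λ_W` imply `f(∇²φ) ≤ √(Λ_V/λ_W)` for the
Brenier map `∇φ` from `μ = e^{-V}dx` to `ν = e^{-W}dx`. -/
theorem good_function_bound_brenier {d : ℕ} (hd : 1 ≤ d)
    (f : Matrix (Fin d) (Fin d) ℝ → ℝ)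
    -- `f` is a good function on the space of symmetric matrices:
    (hf_cont : Continuous f)
    (hf_convex : ConvexOn ℝ {A : Matrix (Fin d) (Fin d) ℝ | A.IsSymm} f)
    (hf_mono : ∀ X X' : Matrix (Fin d) (Fin d) ℝ,
      X.PosSemidef → (X' - X).PosSemidef → f X ≤ f X')
    (hf_pos : ∀ X : Matrix (Fin d) (Fin d) ℝ, X.PosSemidef → X ≠ 0 → 0 < f X)
    (hf_hom : ∀ t : ℝ, 0 < t → ∀ X : Matrix (Fin d) (Fin d) ℝ, X.IsSymm →
      f (t • X) = t * f X)
    (V W Wstar : EuclideanSpace ℝ (Fin d) → ℝ)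
    (hV : ContDiff ℝ 2 V) (hW : ContDiff ℝ 2 W) (hWstar : ContDiff ℝ 2 Wstar)
    (hWconv : ConvexOn ℝ Set.univ W)
    (hLegendre : ∀ y : EuclideanSpace ℝ (Fin d),
      IsLUB {z : ℝ | ∃ x : EuclideanSpace ℝ (Fin d), z = ⟪x, y⟫ - W x} (Wstar y))
    (μ ν : Measure (EuclideanSpace ℝ (Fin d)))
    (hμ : μ = volume.withDensity fun x => ENNReal.ofReal (Real.exp (-V x)))
    (hν : ν = volume.withDensity fun x => ENNReal.ofReal (Real.exp (-W x)))
    (hμprob : IsProbabilityMeasure μ) (hνprob : IsProbabilityMeasure ν)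
    (ΛV lamW : ℝ) (hΛV : 0 < ΛV) (hlamW : 0 < lamW)
    (hVbound : ∀ x, f (hessianMatrix V x) ≤ ΛV)
    (hWstarbound : ∀ x, f (hessianMatrix Wstar x) ≤ 1 / lamW)
    (φ : EuclideanSpace ℝ (Fin d) → ℝ)
    (hφ : ContDiff ℝ 2 φ) (hφconv : ConvexOn ℝ Set.univ φ)
    (hpush : Measure.map (fun x => gradient φ x) μ = ν) :
    ∀ x, f (hessianMatrix φ x) ≤ Real.sqrt (ΛV / lamW) := by
  intro x
  have : Nonempty (Fin d) := ⟨⟨0, hd⟩⟩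
  subst hμ hν
  obtain ⟨hpd, hMA, S, hS, hST, hTS⟩ :=
    brenier_structure hV.continuous hW.continuous hφ hφconv hpush
  obtain ⟨hWint, hWone⟩ := integrable_integral_eq_one_of_isProbabilityMeasure
    hW.continuous.neg.rexp.aestronglyMeasurable (fun y => (Real.exp_pos _).le) hνprob
  have hWsconv := convexOn_of_isLUB_legendre hLegendre
  obtain ⟨K, hK0, hK⟩ := exists_quadratic_bound hf_cont hf_mono hf_pos hf_hom (1 / lamW)
  obtain ⟨C, hC, hCx⟩ := exists_trace_support hf_convex hf_mono hf_hom (hpd x)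
  rw [← hCx, ← weightedLaplacian_toEuclideanCLM hφ, ← hST x]
  refine le_of_forall_gt_imp_ge_of_dense fun κ hκ => ?_
  have hκ0 : 0 < κ := (Real.sqrt_nonneg _).trans_lt hκ
  refine weightedLaplacian_le_of_mul_lt (toEuclideanCLM (𝕜 := ℝ) C) hV hLegendre hWconv hW hWstar
    hWint hWone hφ hφconv hpd hMA hS hTS hΛV.le (one_div_pos.2 hlamW) (fun z => ?_) (fun z => ?_)
    hK0 (fun z u => ?_) hκ0 ?_ _
  · rw [weightedLaplacian_toEuclideanCLM hV]
    exact (hC _ (hessianMatrix_isSymm hV z)).trans (hVbound z)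
  · rw [weightedLaplacian_toEuclideanCLM hWstar]
    exact (hC _ (hessianMatrix_isSymm hWstar z)).trans (hWstarbound z)
  · rw [← dotProduct_hessianMatrix_mulVec hWstar]
    exact hK _ (posSemidef_hessianMatrix hWstar hWsconv z) (hWstarbound z) u
  · rw [mul_one_div]
    exact (Real.sqrt_lt' hκ0).1 hκ
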